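/- arXiv:1003.5996 — 9 statements merged into one kernel-verified Lean document; each statement's English description precedes it below -/
import Mathlib

section
/- Let N ≥ 1, let a, b > 0 be real numbers, and let λ_1 ≥ λ_2 ≥ … ≥ λ_N ≥ 0 be a weakly decreasing sequence of natural numbers with ℓ := #{i : λ_i > 0} its number of nonzero parts. Then the ratio (∫_{[0,1]^N} det(x_i^{λ_j+N−j})_{1≤i,j≤N} · ∏_{1≤i<j≤N}(x_i−x_j) · ∏_{i=1}^N x_i^{a−1}(1−x_i)^{b−1} dx_1⋯dx_N) / (∫_{[0,1]^N} ∏_{1≤i<j≤N}(x_i−x_j)^2 · ∏_{i=1}^N x_i^{a−1}(1−x_i)^{b−1} dx_1⋯dx_N) equals ∏_{i=1}^{ℓ} [ ∏_{j=i+1}^{ℓ} (λ_i−λ_j+j−i)/(j−i) · ∏_{j=0}^{λ_i−1} ((j+N−i+1)(a+N−i+j)) / ((ℓ+j−i+1)(a+b+2N−i+j−1)) ]. -/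
open Finset MeasureTheory

open Polynomial in
/-- The determinant of the Jacobi moment polynomials is a nonzero multiple of the Vandermonde
determinant of the evaluation points. -/
theorem exists_det_moment_eq_mul_det_vandermonde (N : ℕ) (a b : ℝ) (hb : 0 < b) :
    ∃ C : ℝ, C ≠ 0 ∧ ∀ m : Fin N → ℝ,
      (Matrix.of fun i p : Fin N =>
        (∏ k ∈ range (N - 1 - p), (m i + (a + k))) *
          ∏ k ∈ Ico (N - 1 - p : ℕ) (N - 1), (m i + (a + b + k))).det =
        (Matrix.vandermonde m).det * C := by
  let P : Fin N → ℝ[X] := fun p =>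
    (∏ k ∈ range (N - 1 - p), (X + Polynomial.C (a + k))) *
      ∏ k ∈ Ico (N - 1 - p : ℕ) (N - 1), (X + Polynomial.C (a + b + k))
  have hdeg : ∀ p, (P p).natDegree < N := by
    intro p
    have hp := p.2
    have h1 := natDegree_prod_le (range (N - 1 - p)) (fun k : ℕ => X + Polynomial.C (a + k))
    have h2 := natDegree_prod_le (Ico (N - 1 - p : ℕ) (N - 1))
      (fun k : ℕ => X + Polynomial.C (a + b + k))
    simp only [natDegree_X_add_C, sum_const, card_range, Nat.card_Ico, smul_eq_mul, mul_one]
      at h1 h2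
    have h3 : (P p).natDegree ≤ _ := natDegree_mul_le
    omega
  have key : ∀ m : Fin N → ℝ,
      (Matrix.of fun i p : Fin N =>
        (∏ k ∈ range (N - 1 - p), (m i + (a + k))) *
          ∏ k ∈ Ico (N - 1 - p : ℕ) (N - 1), (m i + (a + b + k))).det =
        (Matrix.vandermonde m).det * (Matrix.of fun i p : Fin N => (P p).coeff i).det := by
    intro m
    rw [← Matrix.det_mul]
    congr 1
    ext i p
    have h := eval_eq_sum_range' (hdeg p) (m i)
    rw [← Fin.sum_univ_eq_sum_range (fun k => (P p).coeff k * m i ^ k)] at h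
    simp only [Matrix.mul_apply, Matrix.of_apply, Matrix.vandermonde_apply]
    simp only [P, eval_mul, eval_prod, eval_add, eval_X, eval_C] at h
    rw [h]
    exact sum_congr rfl fun _ _ => mul_comm _ _
  refine ⟨_, ?_, key⟩
  have hk := key fun i => -a - ((N - 1 - i : ℕ) : ℝ)
  intro h0
  rw [h0, mul_zero, Matrix.det_of_isUpperTriangular, prod_eq_zero_iff] at hk
  · obtain ⟨p, -, hp⟩ := hk
    rw [Matrix.of_apply, mul_eq_zero, prod_eq_zero_iff, prod_eq_zero_iff] at hp
    rcases hp with ⟨k, hk, h⟩ | ⟨k, hk, h⟩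
    · have : (k : ℝ) < (N - 1 - p : ℕ) := by exact_mod_cast mem_range.1 hk
      linarith
    · have : ((N - 1 - p : ℕ) : ℝ) ≤ k := by exact_mod_cast (mem_Ico.1 hk).1
      linarith
  · intro i p hip
    have hip : (p : ℕ) < i := hip
    have hi := i.2
    rw [Matrix.of_apply, prod_eq_zero (i := N - 1 - (i : ℕ)), zero_mul]
    · rw [mem_range]; omega
    · ring

/-- **Andréief identity**. -/
theorem integral_det_mul_det_mul_prod {ι α : Type*} [Fintype ι] [DecidableEq ι]
    [MeasurableSpace α] (μ : Measure α) [SigmaFinite μ] (f g : ι → α → ℝ) (w : α → ℝ)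
    (hfg : ∀ j p, Integrable (fun x => f j x * g p x * w x) μ) :
    ∫ x : ι → α, (Matrix.of fun i j => f j (x i)).det * (Matrix.of fun i j => g j (x i)).det *
        ∏ i, w (x i) ∂(Measure.pi fun _ => μ) =
      (Fintype.card ι).factorial * (Matrix.of fun j p => ∫ x, f j x * g p x * w x ∂μ).det := by
  have hexp : ∀ x : ι → α, (Matrix.of fun i j => f j (x i)).det *
      (Matrix.of fun i j => g j (x i)).det * ∏ i, w (x i) =
      ∑ σ : Equiv.Perm ι, ∑ τ : Equiv.Perm ι,
        ((Equiv.Perm.sign σ : ℤ) : ℝ) * (((Equiv.Perm.sign τ : ℤ) : ℝ) *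
          ∏ i, (f (σ i) (x i) * g (τ i) (x i) * w (x i))) := by
    intro x
    rw [← Matrix.det_transpose, ← Matrix.det_transpose (Matrix.of fun i j => g j (x i)),
      Matrix.det_apply', Matrix.det_apply', sum_mul_sum, sum_mul]
    refine sum_congr rfl fun σ _ => ?_
    rw [sum_mul]
    refine sum_congr rfl fun τ _ => ?_
    simp only [Matrix.transpose_apply, Matrix.of_apply, prod_mul_distrib]
    ring
  have hint : ∀ σ τ : Equiv.Perm ι, Integrable (fun x : ι → α =>
      ∏ i, (f (σ i) (x i) * g (τ i) (x i) * w (x i))) (Measure.pi fun _ => μ) := fun σ τ =>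
    Integrable.fintype_prod (f := fun i y => f (σ i) y * g (τ i) y * w y) fun i => hfg _ _
  simp_rw [hexp]
  rw [integral_finsetSum _ fun σ _ => integrable_finsetSum _ fun τ _ =>
    ((hint σ τ).const_mul _).const_mul _]
  have hσ : ∀ σ : Equiv.Perm ι, ∫ x : ι → α, ∑ τ : Equiv.Perm ι,
        ((Equiv.Perm.sign σ : ℤ) : ℝ) * (((Equiv.Perm.sign τ : ℤ) : ℝ) *
          ∏ i, (f (σ i) (x i) * g (τ i) (x i) * w (x i))) ∂(Measure.pi fun _ => μ) =
      (Matrix.of fun j p => ∫ x, f j x * g p x * w x ∂μ).det := by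
    intro σ
    rw [integral_finsetSum _ fun τ _ => ((hint σ τ).const_mul _).const_mul _]
    simp_rw [integral_const_mul]
    rw [← mul_sum]
    have h := Matrix.det_permute σ (Matrix.of fun j p => ∫ x, f j x * g p x * w x ∂μ)
    rw [← Matrix.det_transpose, Matrix.det_apply'] at h
    simp only [Matrix.transpose_apply, Matrix.submatrix_apply, Matrix.of_apply, id] at h
    have hprod : ∀ τ : Equiv.Perm ι,
        ∫ x : ι → α, ∏ i, (f (σ i) (x i) * g (τ i) (x i) * w (x i)) ∂(Measure.pi fun _ => μ) =
          ∏ i, ∫ x, f (σ i) x * g (τ i) x * w x ∂μ := fun τ =>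
      integral_fintype_prod_eq_prod (fun i y => f (σ i) y * g (τ i) y * w y)
    simp_rw [hprod]
    rw [h, ← mul_assoc, ← Int.cast_mul, ← Units.val_mul, Int.units_mul_self, Units.val_one,
      Int.cast_one, one_mul]
  simp_rw [hσ]
  rw [sum_const, card_univ, Fintype.card_perm, nsmul_eq_mul]

theorem beta_add_one_left {s t : ℝ} (hs : 0 < s) (ht : 0 < t) :
    ProbabilityTheory.beta (s + 1) t = ProbabilityTheory.beta s t * (s / (s + t)) := by
  have h : s + 1 + t = (s + t) + 1 := by ring
  rw [ProbabilityTheory.beta, ProbabilityTheory.beta, h, Real.Gamma_add_one hs.ne',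
    Real.Gamma_add_one (by positivity)]
  have := (Real.Gamma_pos_of_pos (add_pos hs ht)).ne'
  field_simp

theorem beta_add_natCast_left {s t : ℝ} (hs : 0 < s) (ht : 0 < t) (n : ℕ) :
    ProbabilityTheory.beta (s + n) t =
      ProbabilityTheory.beta s t * ((∏ k ∈ range n, (s + k)) / ∏ k ∈ range n, (s + t + k)) := by
  induction n with
  | zero => simp
  | succ n ih =>
    rw [Nat.cast_succ, ← add_assoc, beta_add_one_left (by positivity) ht, ih, prod_range_succ,
      prod_range_succ, mul_div_mul_comm, mul_assoc, add_right_comm s (n : ℝ) t]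

theorem ofReal_rpow_mul_rpow_eq_cpow {s t x : ℝ} (hx : x ∈ Set.Icc (0 : ℝ) 1) :
    ((x ^ (s - 1) * (1 - x) ^ (t - 1) : ℝ) : ℂ) =
      (x : ℂ) ^ ((s : ℂ) - 1) * (1 - (x : ℂ)) ^ ((t : ℂ) - 1) := by
  rw [Complex.ofReal_mul, Complex.ofReal_cpow hx.1, Complex.ofReal_cpow (sub_nonneg.2 hx.2)]
  push_cast
  rfl

theorem integrableOn_rpow_mul_rpow {s t : ℝ} (hs : 0 < s) (ht : 0 < t) :
    IntegrableOn (fun x : ℝ => x ^ (s - 1) * (1 - x) ^ (t - 1)) (Set.Icc 0 1) := by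
  have h := Complex.betaIntegral_convergent (u := s) (v := t) (by simpa) (by simpa)
  rw [intervalIntegrable_iff_integrableOn_Icc_of_le zero_le_one] at h
  refine (Integrable.re h).congr ?_
  filter_upwards [ae_restrict_mem measurableSet_Icc] with x hx
  rw [← ofReal_rpow_mul_rpow_eq_cpow hx]
  rfl

theorem setIntegral_rpow_mul_rpow {s t : ℝ} (hs : 0 < s) (ht : 0 < t) :
    ∫ x in Set.Icc (0 : ℝ) 1, x ^ (s - 1) * (1 - x) ^ (t - 1) = ProbabilityTheory.beta s t := by
  rw [ProbabilityTheory.beta_eq_betaIntegralReal s t hs ht, Complex.betaIntegral,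
    intervalIntegral.integral_of_le zero_le_one, ← integral_Icc_eq_integral_Ioc,
    ← Complex.ofReal_re (∫ x in Set.Icc (0 : ℝ) 1, _), ← integral_complex_ofReal]
  congr 1
  exact setIntegral_congr_fun measurableSet_Icc fun x hx => ofReal_rpow_mul_rpow_eq_cpow hx

theorem pow_mul_pow_mul_jacobi_ae_eq (a b : ℝ) (n p : ℕ) :
    (fun x : ℝ => x ^ n * x ^ p * (x ^ (a - 1) * (1 - x) ^ (b - 1)))
      =ᵐ[volume.restrict (Set.Icc 0 1)]
      fun x => x ^ (a + (n + p : ℕ) - 1) * (1 - x) ^ (b - 1) := by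
  filter_upwards [ae_restrict_mem measurableSet_Icc, ae_restrict_of_ae (Measure.ae_ne volume 0)]
    with x hx hx0
  rw [add_sub_right_comm, Real.rpow_add_natCast hx0, pow_add]
  ring

theorem prod_sub_eq_det_pow {R : Type*} [CommRing R] {N : ℕ} (x : Fin N → R) :
    ∏ i, ∏ j ∈ Finset.Ioi i, (x i - x j) =
      (Matrix.of fun i p : Fin N => x i ^ (N - 1 - (p : ℕ))).det := by
  have h := Matrix.det_projVandermonde (fun _ => 1) x
  simp only [one_mul] at h
  rw [← h]
  congr 1
  ext i p
  simp only [Matrix.projVandermonde_apply, one_pow, one_mul, Matrix.of_apply, Fin.val_rev]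
  congr 1
  omega

theorem integral_det_pow_mul_prod_sub_mul_jacobi (N : ℕ) {a b : ℝ} (ha : 0 < a) (hb : 0 < b) :
    ∃ D : ℝ, D ≠ 0 ∧ ∀ m : Fin N → ℕ,
      ∫ x in Set.univ.pi (fun _ : Fin N => Set.Icc (0 : ℝ) 1),
        (Matrix.det (Matrix.of fun i j : Fin N => x i ^ m j)) *
          (∏ i, ∏ j ∈ Finset.Ioi i, (x i - x j)) *
          ∏ i, x i ^ (a - 1) * (1 - x i) ^ (b - 1) =
      D * ((∏ j, (∏ k ∈ range (m j), (a + k)) / ∏ k ∈ range (m j + (N - 1)), (a + b + k)) *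
        ∏ i, ∏ j ∈ Finset.Ioi i, ((m j : ℝ) - m i)) := by
  obtain ⟨C, hC, hdet⟩ := exists_det_moment_eq_mul_det_vandermonde N a b hb
  have hβ := ProbabilityTheory.beta_pos ha hb
  refine ⟨N.factorial * ProbabilityTheory.beta a b ^ N * C, by positivity, fun m => ?_⟩
  have hpos : ∀ n : ℕ, 0 < a + n := fun n => by positivity
  have hint : ∀ n p : ℕ, Integrable
      (fun x : ℝ => x ^ n * x ^ p * (x ^ (a - 1) * (1 - x) ^ (b - 1)))
      (volume.restrict (Set.Icc 0 1)) := fun n p =>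
    (integrableOn_rpow_mul_rpow (hpos (n + p)) hb).congr (pow_mul_pow_mul_jacobi_ae_eq a b n p).symm
  simp_rw [prod_sub_eq_det_pow]
  rw [volume_pi, Measure.restrict_pi_pi,
    integral_det_mul_det_mul_prod (volume.restrict (Set.Icc (0 : ℝ) 1))
      (fun (j : Fin N) (x : ℝ) => x ^ m j) (fun (p : Fin N) (x : ℝ) => x ^ (N - 1 - (p : ℕ)))
      (fun x => x ^ (a - 1) * (1 - x) ^ (b - 1)) (fun j p => hint _ _), Fintype.card_fin]
  have hmom : ∀ j p : Fin N,
      ∫ x in Set.Icc (0 : ℝ) 1,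
        x ^ m j * x ^ (N - 1 - (p : ℕ)) * (x ^ (a - 1) * (1 - x) ^ (b - 1)) =
      (ProbabilityTheory.beta a b *
        ((∏ k ∈ range (m j), (a + k)) / ∏ k ∈ range (m j + (N - 1)), (a + b + k))) *
      ((∏ k ∈ range (N - 1 - p), ((m j : ℝ) + (a + k))) *
          ∏ k ∈ Ico (N - 1 - p : ℕ) (N - 1), ((m j : ℝ) + (a + b + k))) := by
    intro j p
    rw [integral_congr_ae (pow_mul_pow_mul_jacobi_ae_eq a b _ _),
      setIntegral_rpow_mul_rpow (hpos _) hb, beta_add_natCast_left ha hb, mul_assoc]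
    congr 1
    have hle : N - 1 - (p : ℕ) ≤ N - 1 := Nat.sub_le _ _
    have hB : ∀ n : ℕ, ∏ k ∈ range n, (a + b + k) ≠ 0 := fun n =>
      prod_ne_zero_iff.2 fun k _ => by positivity
    rw [div_mul_eq_mul_div, div_eq_div_iff (hB _) (hB _), prod_range_add _ (m j) (N - 1 - p),
      prod_range_add _ (m j) (N - 1 - p), prod_range_add _ (m j) (N - 1),
      ← prod_range_mul_prod_Ico _ hle]
    have h1 : ∀ k : ℕ, a + ((m j + k : ℕ) : ℝ) = m j + (a + k) := fun k => by push_cast; ring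
    have h2 : ∀ k : ℕ, a + b + ((m j + k : ℕ) : ℝ) = m j + (a + b + k) := fun k => by
      push_cast; ring
    simp_rw [h1, h2]
    ring
  simp_rw [hmom]
  have hrow := Matrix.det_mul_column
    (fun j : Fin N => ProbabilityTheory.beta a b *
        ((∏ k ∈ range (m j), (a + k)) / ∏ k ∈ range (m j + (N - 1)), (a + b + k)))
    (Matrix.of fun i p : Fin N =>
        (∏ k ∈ range (N - 1 - p), ((m i : ℝ) + (a + k))) *
          ∏ k ∈ Ico (N - 1 - p : ℕ) (N - 1), ((m i : ℝ) + (a + b + k)))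
  simp only [Matrix.of_apply] at hrow
  rw [hrow, hdet, Matrix.det_vandermonde, prod_mul_distrib, prod_const, card_univ,
    Fintype.card_fin]
  ring

theorem Fin.prod_univ_add_one_eq_prod_Icc {M : Type*} [CommMonoid M] (N : ℕ) (f : ℕ → M) :
    ∏ i : Fin N, f (i + 1) = ∏ i ∈ Icc 1 N, f i := by
  rw [Fin.prod_univ_eq_prod_range (fun i => f (i + 1)), range_eq_Ico,
    prod_Ico_add' f 0 N 1]
  rfl

theorem Fin.prod_Ioi_add_one_eq_prod_Icc {M : Type*} [CommMonoid M] {N : ℕ} (i : Fin N)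
    (f : ℕ → M) : ∏ j ∈ Ioi i, f (j + 1) = ∏ j ∈ Icc (i + 1 + 1 : ℕ) N, f j := by
  refine prod_nbij (fun j => (j : ℕ) + 1) ?_ ?_ ?_ fun _ _ => rfl
  · intro j hj
    have h := Fin.lt_def.1 (mem_Ioi.1 hj)
    have := j.2
    rw [mem_Icc]
    omega
  · intro j _ k _ h
    exact Fin.ext (Nat.succ_injective h)
  · intro j hj
    obtain ⟨h1, h2⟩ := mem_Icc.1 (mem_coe.1 hj)
    refine ⟨⟨j - 1, by omega⟩, mem_coe.2 (mem_Ioi.2 ?_), ?_⟩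
    · change (i : ℕ) < j - 1
      omega
    · change j - 1 + 1 = j
      omega

theorem prod_range_add_div_comm {x : ℝ} (hx : 0 < x) (L n : ℕ) :
    ∏ j ∈ range n, (x + (L + j : ℕ)) / (x + j) = ∏ k ∈ range L, (x + (n + k : ℕ)) / (x + k) := by
  have hne : ∀ n : ℕ, ∏ k ∈ range n, (x + k) ≠ 0 := fun n =>
    prod_ne_zero_iff.2 fun k _ => by positivity
  rw [prod_div_distrib, prod_div_distrib, div_eq_div_iff (hne _) (hne _), mul_comm,
    ← prod_range_add (fun k : ℕ => x + k), mul_comm (∏ k ∈ range L, _),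
    ← prod_range_add (fun k : ℕ => x + k), add_comm]

theorem schur_jacobi_average (N : ℕ) (hN : 1 ≤ N) (a b : ℝ) (ha : 0 < a) (hb : 0 < b)
    (lam : ℕ → ℕ)
    (hmono : ∀ i j : ℕ, 1 ≤ i → i ≤ j → j ≤ N → lam j ≤ lam i)
    (ℓ : ℕ) (hℓ : ℓ = ((Finset.Icc 1 N).filter fun i => lam i ≠ 0).card) :
    (∫ x in Set.univ.pi (fun _ : Fin N => Set.Icc (0 : ℝ) 1),
        (Matrix.det (Matrix.of fun i j : Fin N =>
            x i ^ (lam ((j : ℕ) + 1) + (N - 1 - (j : ℕ))))) *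
          (∏ i, ∏ j ∈ Finset.Ioi i, (x i - x j)) *
          ∏ i, x i ^ (a - 1) * (1 - x i) ^ (b - 1)) /
      (∫ x in Set.univ.pi (fun _ : Fin N => Set.Icc (0 : ℝ) 1),
        (∏ i, ∏ j ∈ Finset.Ioi i, (x i - x j) ^ 2) *
          ∏ i, x i ^ (a - 1) * (1 - x i) ^ (b - 1)) =
      ∏ i ∈ Finset.Icc 1 ℓ,
        ((∏ j ∈ Finset.Icc (i + 1) ℓ,
            (((lam i : ℝ) - (lam j : ℝ) + (j : ℝ) - (i : ℝ)) / ((j : ℝ) - (i : ℝ)))) *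
          ∏ j ∈ Finset.range (lam i),
            (((j : ℝ) + (N : ℝ) - (i : ℝ) + 1) * (a + (N : ℝ) - (i : ℝ) + (j : ℝ))) /
              (((ℓ : ℝ) + (j : ℝ) - (i : ℝ) + 1) *
                (a + b + 2 * (N : ℝ) - (i : ℝ) + (j : ℝ) - 1))) := by
  obtain ⟨D, hD, hint⟩ := integral_det_pow_mul_prod_sub_mul_jacobi N ha hb
  have hden : ∀ x : Fin N → ℝ, ∏ i, ∏ j ∈ Finset.Ioi i, (x i - x j) ^ 2 =
      (Matrix.of fun i p : Fin N => x i ^ (N - 1 - (p : ℕ))).det *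
        ∏ i, ∏ j ∈ Finset.Ioi i, (x i - x j) := by
    intro x
    rw [← prod_sub_eq_det_pow]
    simp_rw [prod_pow, sq]
  simp_rw [hden]
  rw [hint, hint, mul_div_mul_left _ _ hD, mul_div_mul_comm, ← prod_div_distrib,
    ← prod_div_distrib]
  simp_rw [← prod_div_distrib]
  rw [← prod_mul_distrib]
  have hratio : ∀ i : Fin N,
      ((∏ k ∈ range (lam (i + 1) + (N - 1 - i)), (a + k)) /
          ∏ k ∈ range (lam (i + 1) + (N - 1 - i) + (N - 1)), (a + b + k)) /
        ((∏ k ∈ range (N - 1 - i), (a + k)) /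
          ∏ k ∈ range (N - 1 - i + (N - 1)), (a + b + k)) =
      ∏ k ∈ range (lam (i + 1)), (a + N - (i + 1 : ℕ) + k) /
        (a + b + 2 * N - (i + 1 : ℕ) + k - 1) := by
    intro i
    have hi : (((N - 1 - i : ℕ)) : ℝ) = N - (i + 1 : ℕ) := by
      rw [Nat.sub_sub, add_comm 1, Nat.cast_sub i.2]
    have hi' : (((N - 1 : ℕ)) : ℝ) = N - 1 := by rw [Nat.cast_sub hN, Nat.cast_one]
    have hA : ∀ n : ℕ, ∏ k ∈ range n, (a + k) ≠ 0 := fun n =>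
      prod_ne_zero_iff.2 fun k _ => by positivity
    have hB : ∀ n : ℕ, ∏ k ∈ range n, (a + b + k) ≠ 0 := fun n =>
      prod_ne_zero_iff.2 fun k _ => by positivity
    rw [div_div_div_comm, add_comm (lam _), add_right_comm, prod_range_add, prod_range_add,
      mul_div_cancel_left₀ _ (hA _), mul_div_cancel_left₀ _ (hB _), ← prod_div_distrib]
    refine prod_congr rfl fun k _ => ?_
    push_cast [hi, hi']
    congr 1 <;> ring
  have hsub : ∀ i, ∀ j ∈ Ioi i,
      (((lam ((j : Fin N) + 1) + (N - 1 - j) : ℕ) : ℝ) -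
          ((lam ((i : Fin N) + 1) + (N - 1 - i) : ℕ) : ℝ)) /
        (((N - 1 - j : ℕ) : ℝ) - ((N - 1 - i : ℕ) : ℝ)) =
      ((lam (i + 1) : ℝ) - lam (j + 1) + (j + 1 : ℕ) - (i + 1 : ℕ)) /
        (((j + 1 : ℕ) : ℝ) - (i + 1 : ℕ)) := by
    intro i j _
    have hi : ∀ i : Fin N, (((N - 1 - i : ℕ)) : ℝ) = N - (i + 1 : ℕ) := by
      intro i
      rw [Nat.sub_sub, add_comm 1, Nat.cast_sub i.2]
    rw [Nat.cast_add, Nat.cast_add, hi, hi, ← neg_div_neg_eq]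
    congr 1 <;> ring
  simp_rw [hratio]
  rw [prod_congr rfl fun i _ => congrArg _ ((prod_congr rfl (hsub i)).trans
    (Fin.prod_Ioi_add_one_eq_prod_Icc i fun j =>
      ((lam (i + 1) : ℝ) - lam j + j - (i + 1 : ℕ)) / ((j : ℝ) - (i + 1 : ℕ))))]
  rw [Fin.prod_univ_add_one_eq_prod_Icc N fun i =>
    (∏ k ∈ range (lam i), (a + N - i + k) / (a + b + 2 * N - i + k - 1)) *
      ∏ j ∈ Icc (i + 1) N, ((lam i : ℝ) - lam j + j - i) / ((j : ℝ) - i)]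
  have hℓN : ℓ ≤ N := by
    rw [hℓ]
    exact (card_filter_le _ _).trans (by simp)
  have hzero : ∀ i, ℓ < i → i ≤ N → lam i = 0 := by
    intro i hi hiN
    by_contra h
    have hsubset : Icc 1 i ⊆ (Icc 1 N).filter fun i => lam i ≠ 0 := by
      intro j hj
      rw [mem_Icc] at hj
      rw [mem_filter, mem_Icc]
      have := hmono j i hj.1 hj.2 hiN
      omega
    have := card_le_card hsubset
    rw [← hℓ, Nat.card_Icc] at this
    omega
  rw [← prod_subset (Icc_subset_Icc_right hℓN)]
  · refine prod_congr rfl fun i hi => ?_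
    obtain ⟨hi1, hiℓ⟩ := mem_Icc.1 hi
    have hx : (0 : ℝ) < ℓ - i + 1 := by
      have : (i : ℝ) ≤ ℓ := by exact_mod_cast hiℓ
      linarith
    have hsplit : ∏ j ∈ Icc (i + 1) N, ((lam i : ℝ) - lam j + j - i) / ((j : ℝ) - i) =
        (∏ j ∈ Icc (i + 1) ℓ, ((lam i : ℝ) - lam j + j - i) / ((j : ℝ) - i)) *
          ∏ k ∈ range (lam i), ((k : ℝ) + N - i + 1) / ((ℓ : ℝ) + k - i + 1) := by
      have h := prod_range_add_div_comm hx (lam i) (N - ℓ)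
      have hIcc : ∀ n, Icc (i + 1) n = Ico (i + 1) (n + 1) := fun n => rfl
      rw [hIcc, hIcc, ← prod_Ico_consecutive _ (Nat.add_le_add_right hiℓ 1)
          (Nat.add_le_add_right hℓN 1),
        prod_Ico_eq_prod_range _ (ℓ + 1), Nat.add_sub_add_right]
      congr 1
      refine Eq.trans (prod_congr rfl fun k hk => ?_) (h.trans (prod_congr rfl fun k _ => ?_))
      · rw [mem_range] at hk
        rw [hzero (ℓ + 1 + k) (by omega) (by omega)]
        push_cast
        congr 1 <;> ring
      · push_cast [Nat.cast_sub hℓN]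
        congr 1 <;> ring
    rw [hsplit, mul_comm, mul_assoc, ← prod_mul_distrib]
    simp_rw [div_mul_div_comm]
  · intro i hi hi'
    rw [mem_Icc] at hi hi'
    rw [hzero i (by omega) hi.2, range_zero, prod_empty, one_mul]
    refine prod_eq_one fun j hj => ?_
    rw [mem_Icc] at hj
    have : (i : ℝ) < j := by exact_mod_cast hj.1
    rw [hzero j (by omega) hj.2, sub_self, zero_add, div_self (sub_pos.2 this).ne']
end

section
/- Let k ≥ 1 and N ≥ 1 be natural numbers with k ≤ N, and let a, b > 0 be real numbers. Then I_k(N;a,b) = (1/k!) · Σ_{i=0}^{k−1} (−1)^i · binom(k−1,i) · ∏_{j=−i}^{k−i−1} ( (N+j)(a+N+j−1) ) / ( a+b+2N+j−2 ), where the inner product is over the integers j with −i ≤ j ≤ k−i−1 (equivalently, over m = 0,…,k−1 with j = m−i). -/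
open Finset MeasureTheory

/-- The Jacobi-ensemble average `⟨f⟩_{a,b}` over `[0,1]^N`. -/
noncomputable def jacobiAvg (N : ℕ) (a b : ℝ) (f : (Fin N → ℝ) → ℝ) : ℝ :=
  ((N.factorial : ℝ))⁻¹ *
    ∫ x in Set.univ.pi (fun _ : Fin N => Set.Icc (0 : ℝ) 1),
      f x * (∏ i, ∏ j ∈ Finset.Ioi i, (x i - x j) ^ 2) *
        ∏ i, x i ^ (a - 1) * (1 - x i) ^ (b - 1)

/-- `I_k = ⟨p_k⟩_{a,b} / ⟨1⟩_{a,b}` where `p_k` is the `k`-th power sum. -/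
noncomputable def Ik (k N : ℕ) (a b : ℝ) : ℝ :=
  jacobiAvg N a b (fun x => ∑ i, x i ^ k) / jacobiAvg N a b (fun _ => 1)


section Andreief

variable {ι Ω : Type*} [Fintype ι] [DecidableEq ι]

theorem det_mul_det_eq_sum (f g : ι → Ω → ℝ) (x : ι → Ω) :
    (Matrix.of fun i j => f i (x j)).det * (Matrix.of fun i j => g i (x j)).det =
      ∑ τ : Equiv.Perm ι, ∑ σ : Equiv.Perm ι,
        ((Equiv.Perm.sign τ : ℤ) : ℝ) * ((Equiv.Perm.sign σ : ℤ) : ℝ) *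
          ∏ j, f (σ j) (x j) * g (τ j) (x j) := by
  rw [mul_comm, Matrix.det_apply', Matrix.det_apply', Finset.sum_mul_sum]
  refine sum_congr rfl fun τ _ => sum_congr rfl fun σ _ => ?_
  simp only [Matrix.of_apply, prod_mul_distrib]
  ring

variable [MeasurableSpace Ω]

theorem integrable_det_mul_det (μ : Measure Ω) [SigmaFinite μ] (f g : ι → Ω → ℝ)
    (h : ∀ i j, Integrable (fun x => f i x * g j x) μ) :
    Integrable (fun x : ι → Ω =>
      (Matrix.of fun i j => f i (x j)).det * (Matrix.of fun i j => g i (x j)).det)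
      (Measure.pi fun _ => μ) := by
  simp only [det_mul_det_eq_sum]
  exact integrable_finsetSum _ fun τ _ => integrable_finsetSum _ fun σ _ =>
    (Integrable.fintype_prod (f := fun j y => f (σ j) y * g (τ j) y)
      fun j => h (σ j) (τ j)).const_mul _

/-- **Andréief's identity**. -/
theorem integral_det_mul_det (μ : Measure Ω) [SigmaFinite μ] (f g : ι → Ω → ℝ)
    (h : ∀ i j, Integrable (fun x => f i x * g j x) μ) :
    ∫ x : ι → Ω, (Matrix.of fun i j => f i (x j)).det * (Matrix.of fun i j => g i (x j)).det
        ∂(Measure.pi fun _ => μ) =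
      (Fintype.card ι).factorial * (Matrix.of fun i j => ∫ x, f i x * g j x ∂μ).det := by
  have hint : ∀ σ τ : Equiv.Perm ι, Integrable
      (fun x : ι → Ω => ∏ j, f (σ j) (x j) * g (τ j) (x j)) (Measure.pi fun _ => μ) :=
    fun σ τ => Integrable.fintype_prod (f := fun j y => f (σ j) y * g (τ j) y)
      fun j => h (σ j) (τ j)
  simp only [det_mul_det_eq_sum]
  rw [integral_finsetSum _ fun τ _ => integrable_finsetSum _ fun σ _ => (hint σ τ).const_mul _]
  have key : ∀ τ : Equiv.Perm ι, (∫ x : ι → Ω, ∑ σ : Equiv.Perm ι,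
      ((Equiv.Perm.sign τ : ℤ) : ℝ) * ((Equiv.Perm.sign σ : ℤ) : ℝ) *
        ∏ j, f (σ j) (x j) * g (τ j) (x j) ∂(Measure.pi fun _ => μ)) =
      (Matrix.of fun i j => ∫ x, f i x * g j x ∂μ).det := by
    intro τ
    rw [integral_finsetSum _ fun σ _ => (hint σ τ).const_mul _]
    have hdet := Matrix.det_permute' τ (Matrix.of fun i j => ∫ x, f i x * g j x ∂μ)
    have hsign : ((Equiv.Perm.sign τ : ℤ) : ℝ) * ((Equiv.Perm.sign τ : ℤ) : ℝ) = 1 := by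
      rw [← Int.cast_mul, ← Units.val_mul, Int.units_mul_self]; simp
    calc _ = ((Equiv.Perm.sign τ : ℤ) : ℝ) *
          ((Matrix.of fun i j => ∫ x, f i x * g j x ∂μ).submatrix id τ).det := by
          rw [Matrix.det_apply', mul_sum]
          refine sum_congr rfl fun σ _ => ?_
          rw [integral_const_mul,
            integral_fintype_prod_eq_prod (f := fun j y => f (σ j) y * g (τ j) y)]
          simp [mul_assoc]
      _ = _ := by rw [hdet, ← mul_assoc, hsign, one_mul]
  simp only [key, sum_const, card_univ, Fintype.card_perm, nsmul_eq_mul]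

end Andreief

theorem sum_pow_mul_det_pow {ι : Type*} [Fintype ι] [DecidableEq ι] (k : ℕ) (e : ι → ℕ)
    (x : ι → ℝ) :
    (∑ i, x i ^ k) * (Matrix.of fun i j => x j ^ e i).det =
      ∑ m, (Matrix.of fun i j => x j ^ Function.update e m (e m + k) i).det := by
  simp only [Matrix.det_apply', Matrix.of_apply]
  rw [sum_comm, mul_sum]
  refine sum_congr rfl fun σ _ => ?_
  rw [← mul_sum, mul_left_comm]
  congr 1
  rw [sum_mul, ← Equiv.sum_comp σ (fun m => ∏ i, x i ^ Function.update e m (e m + k) (σ i))]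
  refine sum_congr rfl fun m _ => ?_
  rw [← mul_prod_erase _ _ (mem_univ m), ← mul_prod_erase univ
    (fun i => x i ^ Function.update e (σ m) (e (σ m) + k) (σ i)) (mem_univ m),
    Function.update_self, ← mul_assoc, ← pow_add, add_comm k]
  congr 1
  refine prod_congr rfl fun i hi => ?_
  rw [Function.update_of_ne (by simpa using ne_of_mem_erase hi)]

section BetaMoments

variable {a b : ℝ}

theorem integrableOn_rpow_mul_one_sub_rpow (ha : 0 < a) (hb : 0 < b) :
    IntegrableOn (fun x : ℝ => x ^ (a - 1) * (1 - x) ^ (b - 1)) (Set.Ioc 0 1) := by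
  have h := Complex.betaIntegral_convergent (u := a) (v := b) (by simpa) (by simpa)
  rw [intervalIntegrable_iff_integrableOn_Ioc_of_le zero_le_one] at h
  refine (integrableOn_congr_fun (fun x hx => ?_) measurableSet_Ioc).mp h.re
  have h1 : (0 : ℝ) ≤ 1 - x := by linarith [hx.2]
  have : (x : ℂ) ^ ((a : ℂ) - 1) * (1 - (x : ℂ)) ^ ((b : ℂ) - 1) =
      ((x ^ (a - 1) * (1 - x) ^ (b - 1) : ℝ) : ℂ) := by
    push_cast [Complex.ofReal_cpow hx.1.le, Complex.ofReal_cpow h1]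
    rfl
  simp only [this]
  exact Complex.ofReal_re _

theorem integral_rpow_mul_one_sub_rpow (ha : 0 < a) (hb : 0 < b) :
    ∫ x in Set.Ioc (0 : ℝ) 1, x ^ (a - 1) * (1 - x) ^ (b - 1) = ProbabilityTheory.beta a b := by
  have hC : Complex.betaIntegral a b =
      ((∫ x in Set.Ioc (0 : ℝ) 1, x ^ (a - 1) * (1 - x) ^ (b - 1) : ℝ) : ℂ) := by
    rw [Complex.betaIntegral, intervalIntegral.integral_of_le zero_le_one,
      ← integral_complex_ofReal]
    refine setIntegral_congr_fun measurableSet_Ioc fun x hx => ?_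
    have h1 : (0 : ℝ) ≤ 1 - x := by linarith [hx.2]
    push_cast [Complex.ofReal_cpow hx.1.le, Complex.ofReal_cpow h1]
    rfl
  rw [ProbabilityTheory.beta_eq_betaIntegralReal a b ha hb, hC, Complex.ofReal_re]

theorem pow_mul_rpow_mul_eqOn (a b : ℝ) (n : ℕ) :
    Set.EqOn (fun x : ℝ => x ^ (a + n - 1) * (1 - x) ^ (b - 1))
      (fun x : ℝ => x ^ n * (x ^ (a - 1) * (1 - x) ^ (b - 1))) (Set.Ioc 0 1) := by
  intro x hx
  simp only
  rw [← mul_assoc, ← Real.rpow_natCast x n, ← Real.rpow_add hx.1]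
  ring_nf

theorem integrableOn_pow_mul_weight (ha : 0 < a) (hb : 0 < b) (n : ℕ) :
    IntegrableOn (fun x : ℝ => x ^ n * (x ^ (a - 1) * (1 - x) ^ (b - 1))) (Set.Icc 0 1) := by
  rw [integrableOn_Icc_iff_integrableOn_Ioc]
  exact (integrableOn_congr_fun (pow_mul_rpow_mul_eqOn a b n) measurableSet_Ioc).mp
    (integrableOn_rpow_mul_one_sub_rpow (by positivity) hb)

theorem integral_pow_mul_weight (ha : 0 < a) (hb : 0 < b) (n : ℕ) :
    ∫ x in Set.Icc (0 : ℝ) 1, x ^ n * (x ^ (a - 1) * (1 - x) ^ (b - 1)) =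
      ProbabilityTheory.beta (a + n) b := by
  rw [integral_Icc_eq_integral_Ioc,
    ← setIntegral_congr_fun measurableSet_Ioc (pow_mul_rpow_mul_eqOn a b n),
    integral_rpow_mul_one_sub_rpow (by positivity) hb]

end BetaMoments

section JacobiAlternants

variable {N : ℕ} {a b : ℝ}

theorem weighted_alternants_eq_det_mul_det (a b : ℝ) (e : Fin N → ℕ) (x : Fin N → ℝ) :
    (Matrix.of fun i j => x j ^ e i).det * (Matrix.of fun i j : Fin N => x j ^ (i : ℕ)).det *
        ∏ i, x i ^ (a - 1) * (1 - x i) ^ (b - 1) =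
      (Matrix.of fun i j => x j ^ e i).det *
        (Matrix.of fun i j : Fin N =>
          x j ^ (i : ℕ) * (x j ^ (a - 1) * (1 - x j) ^ (b - 1))).det := by
  have := Matrix.det_mul_row (fun j => x j ^ (a - 1) * (1 - x j) ^ (b - 1))
    (Matrix.of fun i j : Fin N => x j ^ (i : ℕ))
  simp only [Matrix.of_apply] at this
  simp_rw [mul_comm (x _ ^ (_ : ℕ)) (x _ ^ (a - 1) * _), this]
  ring

theorem integrable_weighted_alternants (ha : 0 < a) (hb : 0 < b) (e : Fin N → ℕ) :
    IntegrableOn (fun x : Fin N → ℝ =>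
      (Matrix.of fun i j => x j ^ e i).det * (Matrix.of fun i j : Fin N => x j ^ (i : ℕ)).det *
        ∏ i, x i ^ (a - 1) * (1 - x i) ^ (b - 1))
      (Set.univ.pi fun _ => Set.Icc 0 1) := by
  simp only [weighted_alternants_eq_det_mul_det]
  rw [IntegrableOn, volume_pi, Measure.restrict_pi_pi]
  refine integrable_det_mul_det _ (fun i y => y ^ e i)
    (fun (i : Fin N) y => y ^ (i : ℕ) * (y ^ (a - 1) * (1 - y) ^ (b - 1))) fun i j => ?_
  simp only [← mul_assoc, ← pow_add]
  simpa only [IntegrableOn, ← mul_assoc] using integrableOn_pow_mul_weight ha hb (e i + j)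

theorem integral_weighted_alternants (ha : 0 < a) (hb : 0 < b) (e : Fin N → ℕ) :
    ∫ x in Set.univ.pi fun _ : Fin N => Set.Icc (0 : ℝ) 1,
      (Matrix.of fun i j => x j ^ e i).det * (Matrix.of fun i j : Fin N => x j ^ (i : ℕ)).det *
        ∏ i, x i ^ (a - 1) * (1 - x i) ^ (b - 1) =
      N.factorial * (Matrix.of fun i j : Fin N =>
        ProbabilityTheory.beta (a + e i + (j : ℕ)) b).det := by
  simp only [weighted_alternants_eq_det_mul_det]
  have hmul : ∀ (i j : Fin N) (y : ℝ),
      y ^ e i * (y ^ (j : ℕ) * (y ^ (a - 1) * (1 - y) ^ (b - 1))) =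
        y ^ (e i + j) * (y ^ (a - 1) * (1 - y) ^ (b - 1)) := by
    intro i j y; ring
  rw [volume_pi, Measure.restrict_pi_pi, integral_det_mul_det _ (fun i y => y ^ e i)
    (fun (i : Fin N) y => y ^ (i : ℕ) * (y ^ (a - 1) * (1 - y) ^ (b - 1)))]
  · simp only [hmul, integral_pow_mul_weight ha hb, Fintype.card_fin]
    simp only [Nat.cast_add, add_assoc]
  · intro i j
    simp only [hmul]
    exact integrableOn_pow_mul_weight ha hb (e i + j)

theorem prod_sub_sq_eq_det_sq (x : Fin N → ℝ) :
    ∏ i, ∏ j ∈ Finset.Ioi i, (x i - x j) ^ 2 =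
      (Matrix.of fun i j : Fin N => x j ^ (i : ℕ)).det *
        (Matrix.of fun i j : Fin N => x j ^ (i : ℕ)).det := by
  have h : (Matrix.of fun i j : Fin N => x j ^ (i : ℕ)).det = (Matrix.vandermonde x).det := by
    rw [← Matrix.det_transpose]; rfl
  rw [h, Matrix.det_vandermonde, ← sq, ← prod_pow]
  refine prod_congr rfl fun i _ => ?_
  rw [← prod_pow]
  exact prod_congr rfl fun j _ => by ring

theorem jacobiAvg_one_eq_det (ha : 0 < a) (hb : 0 < b) :
    jacobiAvg N a b (fun _ => 1) =
      (Matrix.of fun i j : Fin N => ProbabilityTheory.beta (a + (i : ℕ) + (j : ℕ)) b).det := by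
  have h := integral_weighted_alternants (N := N) ha hb (fun i => i)
  simp only [jacobiAvg, one_mul, prod_sub_sq_eq_det_sq]
  rw [h, inv_mul_cancel_left₀ (by positivity)]

theorem jacobiAvg_powerSum_eq_sum_det (ha : 0 < a) (hb : 0 < b) (k : ℕ) :
    jacobiAvg N a b (fun x => ∑ i, x i ^ k) =
      ∑ m : Fin N, (Matrix.of fun i j : Fin N => ProbabilityTheory.beta
        (a + (Function.update (fun l : Fin N => (l : ℕ)) m (m + k) i : ℕ) + (j : ℕ)) b).det := by
  simp only [jacobiAvg, prod_sub_sq_eq_det_sq, ← mul_assoc,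
    sum_pow_mul_det_pow k (fun l : Fin N => (l : ℕ)), sum_mul]
  rw [integral_finsetSum _ fun m _ => integrable_weighted_alternants ha hb _, mul_sum]
  refine sum_congr rfl fun m _ => ?_
  rw [integral_weighted_alternants ha hb, inv_mul_cancel_left₀ (by positivity)]

end JacobiAlternants

theorem Real.Gamma_add_natCast_eq_mul_prod {y : ℝ} (hy : 0 < y) (n : ℕ) :
    Real.Gamma (y + n) = Real.Gamma y * ∏ t ∈ range n, (y + t) := by
  induction n with
  | zero => simp
  | succ n ih =>
    rw [prod_range_succ, ← mul_assoc, ← ih, Nat.cast_succ, ← add_assoc,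
      Real.Gamma_add_one (by positivity), mul_comm]

section BetaDeterminant

open Polynomial

/-- The polynomial `(X)_j (X + b + j)_{n - j}`. -/
noncomputable def betaNumerator (b : ℝ) (n j : ℕ) : ℝ[X] :=
  (∏ t ∈ range j, (X + C (t : ℝ))) * ∏ t ∈ Ico j n, (X + C (b + t))

theorem eval_betaNumerator (b : ℝ) (n j : ℕ) (y : ℝ) :
    (betaNumerator b n j).eval y =
      (∏ t ∈ range j, (y + t)) * ∏ t ∈ Ico j n, (y + (b + t)) := by
  simp [betaNumerator, eval_prod]

theorem natDegree_betaNumerator_le (b : ℝ) {n j : ℕ} (hj : j ≤ n) :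
    (betaNumerator b n j).natDegree ≤ n := by
  refine natDegree_mul_le.trans ((add_le_add (natDegree_prod_le _ _) (natDegree_prod_le _ _)).trans
    ?_)
  simp only [natDegree_X_add_C, sum_const, card_range, Nat.card_Ico, smul_eq_mul]
  omega

theorem beta_add_natCast {b y : ℝ} (hb : 0 < b) (hy : 0 < y) {n j : ℕ} (hj : j ≤ n) :
    ProbabilityTheory.beta (y + j) b =
      Real.Gamma b * Real.Gamma y / Real.Gamma (y + b + n) * (betaNumerator b n j).eval y := by
  have h1 := Real.Gamma_add_natCast_eq_mul_prod hy j
  have h2 := Real.Gamma_add_natCast_eq_mul_prod (add_pos hy hb) j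
  have h3 := Real.Gamma_add_natCast_eq_mul_prod (add_pos hy hb) n
  rw [← prod_range_mul_prod_Ico _ hj, ← mul_assoc, ← h2] at h3
  have h4 : 0 < Real.Gamma (y + b + j) := Real.Gamma_pos_of_pos (by positivity)
  have h5 : 0 < ∏ t ∈ Ico j n, (y + b + t) := prod_pos fun t _ => by positivity
  rw [ProbabilityTheory.beta, eval_betaNumerator, add_right_comm, h3, h1]
  simp only [← add_assoc]
  field_simp

theorem det_eval_eq_det_vandermonde_mul_det_coeff {R : Type*} [CommRing R] {n : ℕ}
    (v : Fin n → R) (p : Fin n → R[X]) (hp : ∀ j, (p j).natDegree < n) :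
    (Matrix.of fun i j => (p j).eval (v i)).det =
      (Matrix.vandermonde v).det * (Matrix.of fun i j : Fin n => (p j).coeff i).det := by
  rw [← Matrix.det_mul]
  congr 1
  ext i j
  rw [Matrix.mul_apply, Matrix.of_apply, eval_eq_sum_range' (hp j),
    ← Fin.sum_univ_eq_sum_range (fun t => (p j).coeff t * v i ^ t)]
  exact sum_congr rfl fun t _ => mul_comm _ _

theorem det_coeff_betaNumerator_ne_zero {b : ℝ} (hb : 0 < b) (n : ℕ) :
    (Matrix.of fun i j : Fin (n + 1) => (betaNumerator b n j).coeff i).det ≠ 0 := by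
  have h := det_eval_eq_det_vandermonde_mul_det_coeff (fun i : Fin (n + 1) => -((i : ℕ) : ℝ))
    (fun j => betaNumerator b n j)
    fun j => Nat.lt_succ_of_le (natDegree_betaNumerator_le b (Nat.le_of_lt_succ j.2))
  refine right_ne_zero_of_mul (a := (Matrix.vandermonde fun i : Fin (n + 1) =>
    -((i : ℕ) : ℝ)).det) ?_
  rw [← h, Matrix.det_of_isLowerTriangular, prod_ne_zero_iff]
  · intro i _
    rw [Matrix.of_apply, eval_betaNumerator]
    refine mul_ne_zero (prod_ne_zero_iff.mpr fun t ht => ?_) (prod_ne_zero_iff.mpr fun t ht => ?_)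
    · have : (t : ℝ) < (i : ℕ) := by exact_mod_cast mem_range.mp ht
      linarith
    · have : ((i : ℕ) : ℝ) ≤ t := by exact_mod_cast (mem_Ico.mp ht).1
      linarith
  · intro i j hij
    rw [Matrix.of_apply, eval_betaNumerator]
    refine mul_eq_zero_of_left (prod_eq_zero (i := (i : ℕ)) (mem_range.mpr ?_) (by simp)) _
    exact hij

theorem det_beta_eq {a b : ℝ} (ha : 0 < a) (hb : 0 < b) {n : ℕ} (e : Fin (n + 1) → ℕ) :
    (Matrix.of fun i j : Fin (n + 1) => ProbabilityTheory.beta (a + e i + (j : ℕ)) b).det =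
      (∏ i, Real.Gamma b * Real.Gamma (a + e i) / Real.Gamma (a + e i + b + n)) *
        (Matrix.vandermonde fun i => (e i : ℝ)).det *
          (Matrix.of fun i j : Fin (n + 1) => (betaNumerator b n j).coeff i).det := by
  have h := det_eval_eq_det_vandermonde_mul_det_coeff (fun i : Fin (n + 1) => (e i : ℝ) + a)
    (fun j => betaNumerator b n j)
    fun j => Nat.lt_succ_of_le (natDegree_betaNumerator_le b (Nat.le_of_lt_succ j.2))
  rw [Matrix.det_vandermonde_add] at h
  rw [mul_assoc, ← h, ← Matrix.det_mul_column]
  congr 1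
  ext i j
  simp only [Matrix.of_apply]
  rw [beta_add_natCast hb (by positivity) (Nat.le_of_lt_succ j.2), add_comm (e i : ℝ) a]

end BetaDeterminant

theorem exists_det_vandermonde_update {n : ℕ} (v : Fin n → ℝ) (m : Fin n) :
    ∃ c : ℝ, ∀ y, (Matrix.vandermonde (Function.update v m y)).det =
      c * ∏ j ∈ univ.erase m, (y - v j) := by
  refine ⟨(-1) ^ (Ioi m).card *
    ∏ i ∈ univ.erase m, ∏ j ∈ (Ioi i).erase m, (v j - v i), fun y => ?_⟩
  rw [Matrix.det_vandermonde, ← mul_prod_erase _ _ (mem_univ m)]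
  have h1 : ∏ j ∈ Ioi m, (Function.update v m y j - Function.update v m y m) =
      (-1) ^ (Ioi m).card * ∏ j ∈ Ioi m, (y - v j) := by
    rw [← prod_const, ← prod_mul_distrib]
    refine prod_congr rfl fun j hj => ?_
    rw [Function.update_self, Function.update_of_ne (mem_Ioi.mp hj).ne']
    ring
  have h2 : ∀ i ∈ univ.erase m,
      ∏ j ∈ Ioi i, (Function.update v m y j - Function.update v m y i) =
        (if i < m then y - v i else 1) * ∏ j ∈ (Ioi i).erase m, (v j - v i) := by
    intro i hi
    have hrest : ∀ j ∈ (Ioi i).erase m,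
        Function.update v m y j - Function.update v m y i = v j - v i := fun j hj => by
      rw [Function.update_of_ne (ne_of_mem_erase hj), Function.update_of_ne (ne_of_mem_erase hi)]
    split_ifs with him
    · rw [← mul_prod_erase _ _ (mem_Ioi.mpr him), prod_congr rfl hrest, Function.update_self,
        Function.update_of_ne (ne_of_mem_erase hi)]
    · rw [← prod_congr rfl hrest, erase_eq_of_notMem (by simpa using him), one_mul]
  have h3 : ∏ j ∈ univ.erase m, (y - v j) =
      (∏ j ∈ Ioi m, (y - v j)) * ∏ i ∈ univ.erase m, if i < m then y - v i else 1 := by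
    rw [← prod_filter_mul_prod_filter_not (univ.erase m) (fun j => m < j), ← prod_filter]
    congr 1
    · exact prod_congr (by ext j; simp; exact fun h => h.ne') fun _ _ => rfl
    · refine prod_congr ?_ fun _ _ => rfl
      ext j
      simp only [mem_filter, mem_erase, mem_univ, and_true, not_lt]
      exact ⟨fun h => ⟨h.1, lt_of_le_of_ne h.2 h.1⟩, fun h => ⟨h.1, h.2.le⟩⟩
  rw [h1, prod_congr rfl h2, prod_mul_distrib, h3]
  ring

theorem det_vandermonde_update_div {n : ℕ} {v : Fin n → ℝ} (hv : Function.Injective v)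
    (m : Fin n) (y : ℝ) :
    (Matrix.vandermonde (Function.update v m y)).det / (Matrix.vandermonde v).det =
      ∏ j ∈ univ.erase m, (y - v j) / (v m - v j) := by
  obtain ⟨c, hc⟩ := exists_det_vandermonde_update v m
  have hm := hc (v m)
  rw [Function.update_eq_self] at hm
  have h0 : c * ∏ j ∈ univ.erase m, (v m - v j) ≠ 0 :=
    hm ▸ Matrix.det_vandermonde_ne_zero_iff.mpr hv
  rw [hc y, hm, prod_div_distrib, mul_div_mul_left _ _ (left_ne_zero_of_mul h0)]

theorem prod_range_add_sub_div (m k : ℕ) :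
    ∏ j ∈ range m, (((m : ℝ) + k - j) / (m - j)) = ((m + k).choose k : ℝ) := by
  rw [← prod_range_reflect]
  have h : ∀ j ∈ range m, ((m : ℝ) + k - ((m - 1 - j : ℕ) : ℝ)) / (m - ((m - 1 - j : ℕ) : ℝ)) =
      ((k : ℝ) + 1 + j) / (1 + j) := by
    intro j hj
    have : m = (m - 1 - j) + 1 + j := by have := mem_range.mp hj; omega
    generalize m - 1 - j = r at this
    subst this
    push_cast
    ring_nf
  rw [prod_congr rfl h]
  clear h
  induction m with
  | zero => simp
  | succ m ih =>
    rw [prod_range_succ, ih, mul_div_assoc', div_eq_iff (by positivity)]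
    have h1 := Nat.add_one_mul_choose_eq (m + k) m
    rw [Nat.choose_symm_add, show m + k + 1 = m + 1 + k by omega, Nat.choose_symm_add] at h1
    have h2 : ((m : ℝ) + 1 + k) * ((m + k).choose k) = ((m + 1 + k).choose k) * (m + 1) := by
      exact_mod_cast h1
    linear_combination h2

theorem prod_range_sub_div_neg (p i : ℕ) :
    ∏ t ∈ range i, (((p : ℝ) - t) / (-(t + 1))) = (-1) ^ i * (p.choose i : ℝ) := by
  induction i with
  | zero => simp
  | succ i ih =>
    have h1 : (p.choose (i + 1) : ℝ) * (i + 1) = p.choose i * (p - i) := by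
      rcases le_or_gt i p with h | h
      · rw [← Nat.cast_sub h]
        exact_mod_cast Nat.choose_succ_right_eq p i
      · rw [Nat.choose_eq_zero_of_lt h, Nat.choose_eq_zero_of_lt (by omega)]
        simp
    have h2 : (-((i : ℝ) + 1)) ≠ 0 := neg_ne_zero.mpr (by positivity)
    rw [prod_range_succ, ih, mul_div_assoc', div_eq_iff h2, pow_succ]
    linear_combination -(-1) ^ i * h1

theorem prod_erase_add_sub_div (m p i : ℕ) :
    ∏ j ∈ (range (m + 1 + i)).erase m, (((m : ℝ) + (p + 1 : ℕ) - j) / (m - j)) =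
      (-1) ^ i * (p.choose i : ℝ) * ((m + (p + 1)).choose (p + 1) : ℝ) := by
  have hset : (range (m + 1 + i)).erase m = range m ∪ Ico (m + 1) (m + 1 + i) := by
    ext j; simp; omega
  have hdisj : Disjoint (range m) (Ico (m + 1) (m + 1 + i)) := by
    rw [disjoint_left]; intro j; simp; omega
  rw [hset, prod_union hdisj, prod_range_add_sub_div, prod_Ico_eq_prod_range,
    ← prod_range_sub_div_neg, mul_comm]
  congr 1
  rw [Nat.add_sub_cancel_left]
  refine prod_congr rfl fun t _ => ?_
  push_cast
  congr 1 <;> ring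

theorem inv_factorial_mul_prod_add (m k : ℕ) :
    ((k.factorial : ℝ))⁻¹ * ∏ t ∈ range k, ((m : ℝ) + 1 + t) = ((m + k).choose k : ℝ) := by
  have h := Nat.ascFactorial_eq_factorial_mul_choose m k
  rw [Nat.ascFactorial_eq_prod_range] at h
  rw [inv_mul_eq_iff_eq_mul₀ (by positivity)]
  exact_mod_cast h

theorem Ik_eq_sum_fin {a b : ℝ} (ha : 0 < a) (hb : 0 < b) (k n : ℕ) :
    Ik k (n + 1) a b = ∑ m : Fin (n + 1),
      (∏ j ∈ (range (n + 1)).erase m, ((((m : ℕ) : ℝ) + k - j) / ((m : ℕ) - j))) *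
        ∏ t ∈ range k, ((a + (m : ℕ) + t) / (a + (m : ℕ) + b + n + t)) := by
  rw [Ik, jacobiAvg_one_eq_det ha hb, jacobiAvg_powerSum_eq_sum_det ha hb, sum_div]
  refine sum_congr rfl fun m _ => ?_
  rw [det_beta_eq ha hb, det_beta_eq ha hb (fun i => (i : ℕ)),
    mul_div_mul_right _ _ (det_coeff_betaNumerator_ne_zero hb n), mul_div_mul_comm, mul_comm]
  congr 1
  · have hinj : Function.Injective fun i : Fin (n + 1) => ((i : ℕ) : ℝ) :=
      Nat.cast_injective.comp Fin.val_injective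
    have h := det_vandermonde_update_div hinj m ((m : ℕ) + k)
    have hup : (fun i : Fin (n + 1) =>
        ((Function.update (fun l : Fin (n + 1) => (l : ℕ)) m (m + k) i : ℕ) : ℝ)) =
        Function.update (fun i : Fin (n + 1) => ((i : ℕ) : ℝ)) m ((m : ℕ) + k) := by
      ext i
      rcases eq_or_ne i m with rfl | hi
      · simp
      · simp [Function.update_of_ne hi]
    rw [hup, h]
    refine prod_bij (fun j _ => (j : ℕ)) (fun j hj => ?_) (fun _ _ _ _ h => Fin.ext h)
      (fun j hj => ?_) fun _ _ => rfl
    · simpa [Fin.val_inj, Nat.le_of_lt_succ j.2] using hj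
    · rw [mem_erase, mem_range] at hj
      exact ⟨⟨j, hj.2⟩, by simpa [Fin.ext_iff] using hj.1, rfl⟩
  · have hpos : ∀ s : ℕ, 0 < Real.Gamma b * Real.Gamma (a + s) / Real.Gamma (a + s + b + n) :=
      fun s => div_pos (mul_pos (Real.Gamma_pos_of_pos hb) (Real.Gamma_pos_of_pos (by positivity)))
        (Real.Gamma_pos_of_pos (by positivity))
    rw [← prod_div_distrib, prod_eq_single m]
    · have h1 := Real.Gamma_add_natCast_eq_mul_prod (y := a + (m : ℕ)) (by positivity) k
      have h2 := Real.Gamma_add_natCast_eq_mul_prod (y := a + (m : ℕ) + b + n) (by positivity) k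
      have h3 : 0 < Real.Gamma (a + (m : ℕ)) := Real.Gamma_pos_of_pos (by positivity)
      have h4 : 0 < Real.Gamma (a + (m : ℕ) + b + n) := Real.Gamma_pos_of_pos (by positivity)
      have h5 : 0 < Real.Gamma b := Real.Gamma_pos_of_pos hb
      have h6 : 0 < ∏ t ∈ range k, (a + (m : ℕ) + b + n + t) := prod_pos fun t _ => by positivity
      rw [Function.update_self, Nat.cast_add,
        show a + (((m : ℕ) : ℝ) + k) = a + (m : ℕ) + k by ring,
        show a + ((m : ℕ) : ℝ) + k + b + n = a + (m : ℕ) + b + n + k by ring, h1, h2,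
        prod_div_distrib]
      field_simp
    · intro i _ hi
      rw [Function.update_of_ne hi, div_self (hpos i).ne']
    · simp

theorem Ik_eq_sum (k N : ℕ) (hk : 1 ≤ k) (hN : 1 ≤ N) (hkN : k ≤ N)
    (a b : ℝ) (ha : 0 < a) (hb : 0 < b) :
    Ik k N a b =
      ((k.factorial : ℝ))⁻¹ *
        ∑ i ∈ Finset.range k, (-1 : ℝ) ^ i * ((k - 1).choose i : ℝ) *
          ∏ m ∈ Finset.range k,
            (((N : ℝ) + ((m : ℝ) - (i : ℝ))) * (a + (N : ℝ) + ((m : ℝ) - (i : ℝ)) - 1)) /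
              (a + b + 2 * (N : ℝ) + ((m : ℝ) - (i : ℝ)) - 2) := by
  obtain ⟨n, rfl⟩ := Nat.exists_eq_add_of_le' hN
  obtain ⟨p, rfl⟩ := Nat.exists_eq_add_of_le' hk
  rw [Ik_eq_sum_fin ha hb, Fin.sum_univ_eq_sum_range (fun m : ℕ =>
    (∏ j ∈ (range (n + 1)).erase m, (((m : ℝ) + (p + 1 : ℕ) - j) / (m - j))) *
      ∏ t ∈ range (p + 1), ((a + m + t) / (a + m + b + n + t))),
    ← sum_range_reflect, mul_sum]
  have hterm : ∀ i ∈ range (n + 1),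
      (∏ j ∈ (range (n + 1)).erase (n + 1 - 1 - i),
        ((((n + 1 - 1 - i : ℕ) : ℝ) + (p + 1 : ℕ) - j) / ((n + 1 - 1 - i : ℕ) - j))) *
      ∏ t ∈ range (p + 1), ((a + (n + 1 - 1 - i : ℕ) + t) /
        (a + (n + 1 - 1 - i : ℕ) + b + n + t)) =
      (((p + 1).factorial : ℝ))⁻¹ * ((-1 : ℝ) ^ i * ((p + 1 - 1).choose i : ℝ) *
        ∏ m ∈ range (p + 1),
          ((((n + 1 : ℕ) : ℝ) + ((m : ℝ) - (i : ℝ))) *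
            (a + ((n + 1 : ℕ) : ℝ) + ((m : ℝ) - (i : ℝ)) - 1)) /
            (a + b + 2 * ((n + 1 : ℕ) : ℝ) + ((m : ℝ) - (i : ℝ)) - 2)) := by
    intro i hi
    obtain ⟨m, rfl⟩ := Nat.exists_eq_add_of_le' (Nat.le_of_lt_succ (mem_range.mp hi))
    have hprod : ∏ t ∈ range (p + 1),
        ((((m + i + 1 : ℕ) : ℝ) + ((t : ℝ) - (i : ℝ))) *
          (a + ((m + i + 1 : ℕ) : ℝ) + ((t : ℝ) - (i : ℝ)) - 1)) /
          (a + b + 2 * ((m + i + 1 : ℕ) : ℝ) + ((t : ℝ) - (i : ℝ)) - 2) =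
        (∏ t ∈ range (p + 1), ((m : ℝ) + 1 + t)) *
          ∏ t ∈ range (p + 1), ((a + m + t) / (a + m + b + (m + i : ℕ) + t)) := by
      rw [← prod_mul_distrib]
      refine prod_congr rfl fun t _ => ?_
      rw [mul_div_assoc']
      push_cast
      congr 1 <;> ring
    rw [hprod, Nat.add_sub_cancel, Nat.add_sub_cancel, Nat.add_sub_cancel,
      show m + i + 1 = m + 1 + i by omega, prod_erase_add_sub_div,
      ← inv_factorial_mul_prod_add]
    ring
  rw [sum_congr rfl hterm]
  refine (sum_subset (range_subset_range.mpr hkN) fun i _ hi => ?_).symm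
  rw [Nat.add_sub_cancel, Nat.choose_eq_zero_of_lt (by simpa using hi)]
  simp
end

section
/- For all natural numbers p ≥ 1 and k ≥ 0, the integer identity Σ_{i=0}^{k+1} (−1)^{k+1−i} · binom(k+1,i) · i^p = (k+1) · Σ_{i=0}^{k} (−1)^{k−i} · binom(k,i) · (i+1)^{p−1} holds. Equivalently, the divided difference of y^p at the nodes 0,1,…,k+1 equals the divided difference of (y+1)^{p−1} at the nodes 0,1,…,k. -/
open Finset

theorem divided_difference_shift (p k : ℕ) (hp : 1 ≤ p) :
    ∑ i ∈ Finset.range (k + 2), (-1 : ℤ) ^ (k + 1 - i) * ((k + 1).choose i : ℤ) * (i : ℤ) ^ p =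
      (k + 1 : ℤ) *
        ∑ i ∈ Finset.range (k + 1), (-1 : ℤ) ^ (k - i) * (k.choose i : ℤ) * ((i : ℤ) + 1) ^ (p - 1) := by
  obtain ⟨q, rfl⟩ := Nat.exists_eq_add_of_le' hp
  rw [Finset.sum_range_succ', Finset.mul_sum]
  simp only [Nat.cast_zero, zero_pow q.succ_ne_zero, mul_zero, add_zero]
  refine Finset.sum_congr rfl fun i _ => ?_
  have h : (k + 1 : ℤ) * k.choose i = (k + 1).choose (i + 1) * (i + 1) := by
    exact_mod_cast Nat.add_one_mul_choose_eq k i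
  rw [Nat.add_sub_add_right, Nat.add_sub_cancel, Nat.cast_succ, pow_succ]
  linear_combination -(-1 : ℤ) ^ (k - i) * ((i : ℤ) + 1) ^ q * h
end

section
/- Let k and p be natural numbers with p ≤ k, and let x, a, b be real numbers. Then Σ_{i=0}^{k−p} (−1)^{k−p−i} · binom(k−p,i) · P_{p+i}^{k}(x;a,b) = ∏_{i=0}^{p−1} (x+b−i) · ∏_{i=0}^{k−p−1} (b−a−p−i). -/
open Finset

/-- `P_i^k(x;a,b) := ∏_{j=0}^{k-i-1} (x+j+a) · ∏_{j=0}^{i-1} (x-j+b)`. -/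
noncomputable def Pik (i k : ℕ) (x a b : ℝ) : ℝ :=
  (∏ j ∈ Finset.range (k - i), (x + (j : ℝ) + a)) *
    ∏ j ∈ Finset.range i, (x - (j : ℝ) + b)

/-- Chu-Vandermonde identity for falling factorials. -/
theorem prod_range_add_sub_eq_sum_antidiagonal {R : Type*} [CommRing R] (w v : R) (n : ℕ) :
    ∏ j ∈ range n, (w + v - (j : R)) =
      ∑ ij ∈ antidiagonal n, (n.choose ij.1 : R) *
        ((∏ j ∈ range ij.1, (v - (j : R))) * ∏ j ∈ range ij.2, (w - (j : R))) := by
  induction n with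
  | zero => simp
  | succ n ih =>
    rw [sum_antidiagonal_choose_succ_mul
      (fun i m => (∏ j ∈ range i, (v - (j : R))) * ∏ j ∈ range m, (w - (j : R))),
      prod_range_succ, ih, sum_mul, ← sum_add_distrib]
    refine sum_congr rfl fun ⟨i, m⟩ h => ?_
    obtain rfl : i + m = n := by simpa using h
    simp only [prod_range_succ, Nat.choose_symm_add (a := i) (b := m)]
    push_cast
    ring

/-- A rising factorial is, up to sign, the falling factorial of the negated argument. -/
theorem neg_one_pow_mul_prod_range_add {R : Type*} [CommRing R] (u : R) (m : ℕ) :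
    (-1) ^ m * ∏ j ∈ range m, (u + (j : R)) = ∏ j ∈ range m, (-u - (j : R)) := by
  induction m with
  | zero => simp
  | succ m ih =>
    rw [prod_range_succ, prod_range_succ, ← ih]
    ring

theorem inverse_binomial_transform_Pik (k p : ℕ) (hpk : p ≤ k) (x a b : ℝ) :
    ∑ i ∈ Finset.range (k - p + 1),
        (-1 : ℝ) ^ (k - p - i) * ((k - p).choose i : ℝ) * Pik (p + i) k x a b =
      (∏ i ∈ Finset.range p, (x + b - (i : ℝ))) *
        ∏ i ∈ Finset.range (k - p), (b - a - (p : ℝ) - (i : ℝ)) := by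
  obtain ⟨n, rfl⟩ := Nat.exists_eq_add_of_le hpk
  have hv := prod_range_add_sub_eq_sum_antidiagonal (-(x + a)) (x + b - (p : ℝ)) n
  have hb : -(x + a) + (x + b - (p : ℝ)) = b - a - p := by ring
  rw [hb, Nat.sum_antidiagonal_eq_sum_range_succ_mk] at hv
  rw [Nat.add_sub_cancel_left, hv, mul_sum]
  refine sum_congr rfl fun i _ => ?_
  have hk : p + n - (p + i) = n - i := by lia
  have hx : ∏ j ∈ range (n - i), (x + (j : ℝ) + a) = ∏ j ∈ range (n - i), (x + a + (j : ℝ)) :=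
    prod_congr rfl fun j _ => by ring
  have hp : ∏ j ∈ range p, (x - (j : ℝ) + b) = ∏ j ∈ range p, (x + b - (j : ℝ)) :=
    prod_congr rfl fun j _ => by ring
  have hi : ∏ j ∈ range i, (x - ((p + j : ℕ) : ℝ) + b) =
      ∏ j ∈ range i, (x + b - (p : ℝ) - (j : ℝ)) :=
    prod_congr rfl fun j _ => by push_cast; ring
  rw [Pik, hk, prod_range_add, hx, hp, hi, ← neg_one_pow_mul_prod_range_add]
  ring
end

section
/- Let m, p, k be natural numbers and let f be a polynomial in two variables x, y with real coefficients and total degree at most m. For each natural number i let f(x,i) denote the one-variable polynomial in x obtained by substituting y = i. Define L_{k,p}(f) := (1/k!) · (coefficient of x^{p+m−k} in Σ_{i=0}^{k} (−1)^{k−i} binom(k,i) · i^p · f(x,i)). Then: if p ≤ k, L_{k,p}(f) = (1/(k−p)!) · (coefficient of x^{m−(k−p)} in Σ_{i=0}^{k−p} (−1)^{k−p−i} binom(k−p,i) · f(x,i+p)), i.e. L_{k,p}(f) = L_{k−p,0}(f_p) where f_p(x,y) := f(x,y+p); and if p > k, then L_{k,p}(f) = 0. -/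
open Finset Polynomial

/-- Substitute `y = c` (second variable) in a bivariate polynomial, producing a
one-variable polynomial in `x`. -/
noncomputable def subY (f : MvPolynomial (Fin 2) ℝ) (c : ℝ) : Polynomial ℝ :=
  MvPolynomial.aeval (fun v : Fin 2 => if v = 0 then (Polynomial.X : Polynomial ℝ)
    else Polynomial.C c) f

/-- `L_{k,p}(f)` relative to the degree bound `m`: `(1/k!)` times the coefficient of
`x^{p+m-k}` in `∑_{i=0}^k (-1)^{k-i} binom(k,i) i^p f(x,i)`; it is `0` when the
exponent `p+m-k` would be negative. -/
noncomputable def Lcoef (m k p : ℕ) (f : MvPolynomial (Fin 2) ℝ) : ℝ :=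
  ((k.factorial : ℝ))⁻¹ *
    (if k ≤ p + m then
      (∑ i ∈ Finset.range (k + 1),
        Polynomial.C ((-1 : ℝ) ^ (k - i) * (k.choose i : ℝ) * (i : ℝ) ^ p) *
          subY f (i : ℝ)).coeff (p + m - k)
    else 0)

/-- The shift `f_p(x,y) := f(x,y+p)`. -/
noncomputable def shiftY (f : MvPolynomial (Fin 2) ℝ) (p : ℕ) : MvPolynomial (Fin 2) ℝ :=
  MvPolynomial.aeval (fun v : Fin 2 => if v = 0 then MvPolynomial.X 0
    else MvPolynomial.X 1 + MvPolynomial.C (p : ℝ)) f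

/-- The coefficient of `x^e` in `f`, as a polynomial in `y`. -/
noncomputable def coeffInX (f : MvPolynomial (Fin 2) ℝ) (e : ℕ) : ℝ[X] :=
  ∑ d ∈ f.support with d 0 = e, monomial (d 1) (f.coeff d)

theorem coeff_subY (f : MvPolynomial (Fin 2) ℝ) (c : ℝ) (e : ℕ) :
    (subY f c).coeff e = (coeffInX f e).eval c := by
  have hterm (d : Fin 2 →₀ ℕ) : (C (f.coeff d) * (X ^ d 0 * C c ^ d 1)).coeff e =
      if d 0 = e then f.coeff d * c ^ d 1 else 0 := by
    rw [← C_pow, mul_comm (X ^ d 0), coeff_C_mul, coeff_C_mul, coeff_X_pow]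
    simp [eq_comm]
  simp [subY, coeffInX, MvPolynomial.aeval_def, MvPolynomial.eval₂_eq', hterm, eval_finsetSum,
    Finset.sum_filter, apply_ite (eval c)]

theorem degree_add_le_of_mem_support {f : MvPolynomial (Fin 2) ℝ} {m : ℕ}
    (hf : f.totalDegree ≤ m) {d : Fin 2 →₀ ℕ} (hd : d ∈ f.support) : d 0 + d 1 ≤ m := by
  have h := (MvPolynomial.le_totalDegree hd).trans hf
  rwa [Finsupp.sum_fintype _ _ fun _ => rfl, Fin.sum_univ_two] at h

theorem natDegree_coeffInX_le {f : MvPolynomial (Fin 2) ℝ} {m : ℕ}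
    (hf : f.totalDegree ≤ m) (e : ℕ) : (coeffInX f e).natDegree ≤ m - e := by
  refine natDegree_sum_le_of_forall_le _ _ fun d hd => (natDegree_monomial_le _).trans ?_
  obtain ⟨hdf, rfl⟩ := Finset.mem_filter.mp hd
  have := degree_add_le_of_mem_support hf hdf
  omega

theorem coeffInX_eq_zero {f : MvPolynomial (Fin 2) ℝ} {m e : ℕ}
    (hf : f.totalDegree ≤ m) (he : m < e) : coeffInX f e = 0 := by
  rw [coeffInX, Finset.filter_false_of_mem, Finset.sum_empty]
  intro d hd
  have := degree_add_le_of_mem_support hf hd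
  omega

theorem subY_shiftY (f : MvPolynomial (Fin 2) ℝ) (p : ℕ) (c : ℝ) :
    subY (shiftY f p) c = subY f (c + p) := by
  unfold subY shiftY
  rw [← AlgHom.comp_apply]
  congr 1
  ext v : 1
  fin_cases v <;> simp

/-- The `k`-th finite difference at `0` extracts `k!` times the coefficient of degree `k`. -/
theorem sum_neg_one_pow_mul_choose_mul_eval {g : ℝ[X]} {k : ℕ} (hg : g.natDegree ≤ k) :
    ∑ i ∈ Finset.range (k + 1), (-1 : ℝ) ^ (k - i) * (k.choose i : ℝ) * g.eval (i : ℝ) =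
      k.factorial * g.coeff k := by
  have h := fwdDiff_iter_eq_sum_shift (1 : ℝ) g.eval k 0
  simp only [zero_add, nsmul_eq_mul, mul_one, zsmul_eq_mul, Int.cast_mul, Int.cast_pow,
    Int.cast_neg, Int.cast_one, Int.cast_natCast] at h
  rw [← h]
  rcases hg.lt_or_eq with hlt | rfl
  · rw [g.fwdDiff_iter_eq_zero_of_degree_lt hlt, coeff_eq_zero_of_natDegree_lt hlt]
    simp
  · rw [g.fwdDiff_iter_degree_eq_factorial]
    simp [mul_comm]

theorem coeff_taylor_of_natDegree_le {g : ℝ[X]} {n : ℕ} (hg : g.natDegree ≤ n) (r : ℝ) :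
    (taylor r g).coeff n = g.coeff n := by
  rcases hg.lt_or_eq with hlt | rfl
  · rw [coeff_eq_zero_of_natDegree_lt hlt, coeff_eq_zero_of_natDegree_lt (by simpa using hlt)]
  · exact coeff_taylor_natDegree r g

theorem leading_coefficient_shift (m k p : ℕ) (f : MvPolynomial (Fin 2) ℝ)
    (hf : f.totalDegree ≤ m) :
    (p ≤ k → Lcoef m k p f = Lcoef m (k - p) 0 (shiftY f p)) ∧
      (k < p → Lcoef m k p f = 0) := by
  have hcoeff (k p e : ℕ) (h : MvPolynomial (Fin 2) ℝ) :
      (∑ i ∈ Finset.range (k + 1),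
        C ((-1 : ℝ) ^ (k - i) * (k.choose i : ℝ) * (i : ℝ) ^ p) * subY h (i : ℝ)).coeff e =
      ∑ i ∈ Finset.range (k + 1),
        (-1 : ℝ) ^ (k - i) * (k.choose i : ℝ) * ((i : ℝ) ^ p * (subY h (i : ℝ)).coeff e) := by
    simp only [finsetSum_coeff, coeff_C_mul, mul_assoc]
  constructor
  · intro hpk
    by_cases hk : k ≤ p + m
    · set g := coeffInX f (p + m - k) with hgdef
      have hg : g.natDegree ≤ k - p :=
        (natDegree_coeffInX_le hf _).trans (by omega)
      have hleft : (X ^ p * g).natDegree ≤ k :=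
        natDegree_mul_le.trans (by rw [natDegree_X_pow]; omega)
      have hright : (taylor (p : ℝ) g).natDegree ≤ k - p := by rwa [natDegree_taylor]
      have hsumL := sum_neg_one_pow_mul_choose_mul_eval hleft
      have hsumR := sum_neg_one_pow_mul_choose_mul_eval hright
      simp only [eval_mul, eval_pow, eval_X] at hsumL
      simp only [taylor_eval] at hsumR
      rw [coeff_X_pow_mul', if_pos hpk] at hsumL
      rw [coeff_taylor_of_natDegree_le hg] at hsumR
      have he : 0 + m - (k - p) = p + m - k := by omega
      rw [Lcoef, Lcoef, if_pos hk, if_pos (by omega), hcoeff, hcoeff, he]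
      simp only [subY_shiftY, coeff_subY, pow_zero, one_mul, ← hgdef]
      rw [hsumL, hsumR, inv_mul_cancel_left₀ (by positivity), inv_mul_cancel_left₀ (by positivity)]
    · rw [Lcoef, Lcoef, if_neg hk, if_neg (by omega), mul_zero, mul_zero]
  · intro hkp
    rw [Lcoef, hcoeff]
    simp [coeff_subY, coeffInX_eq_zero hf (show m < p + m - k by omega)]
end

section
/- Let k and p be natural numbers, let a, b be real numbers, and let c_0,…,c_{p−1}, d_0,…,d_{p−1}, e_0,…,e_{p−1} be real numbers. For each natural number i set g_i(x) := ∏_{j=0}^{p−1} (c_j·x − d_j·i + e_j). Then the coefficient of x^p in the polynomial T̃_k^{a,b}[(g_i)_{0≤i≤k}] equals Σ_{j=0}^{k} (k!/(k−j)!) · ( Σ_{S ⊆ {0,…,p−1}, |S| = j} ∏_{s∈S} d_s · ∏_{t∈{0,…,p−1}∖S} c_t ) · ∏_{i=0}^{k−j−1} (a−b+j+i). (Terms with j > p vanish since there are no subsets of size j, and all parameters e_j are absent from the answer.) -/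
open Finset Polynomial

/-- `P_i^k(x;a,b)` as a polynomial in `x`. -/
noncomputable def PikPoly (i k : ℕ) (a b : ℝ) : Polynomial ℝ :=
  (∏ j ∈ Finset.range (k - i), (Polynomial.X + Polynomial.C ((j : ℝ) + a))) *
    ∏ j ∈ Finset.range i, (Polynomial.X + Polynomial.C (b - (j : ℝ)))

/-- The transform `T̃_k^{a,b}` of a finite family of polynomials. -/
noncomputable def Ttilde (k : ℕ) (a b : ℝ) (g : ℕ → Polynomial ℝ) : Polynomial ℝ :=
  Polynomial.C ((-1 : ℝ) ^ k) *
    ∑ i ∈ Finset.range (k + 1),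
      Polynomial.C ((-1 : ℝ) ^ (k - i) * (k.choose i : ℝ)) * (PikPoly i k a b * g i)

/-- The sum over `S ⊆ {0,…,p-1}` with `|S| = j` of `∏_{s∈S} d s * ∏_{t∉S} c t`. -/
noncomputable def mixedEsymm (c d : ℕ → ℝ) (p j : ℕ) : ℝ :=
  ∑ S ∈ (Finset.range p).powersetCard j, (∏ s ∈ S, d s) * ∏ t ∈ Finset.range p \ S, c t

lemma sum_powersetCard_range_prod_sdiff_range_succ (c d : ℕ → ℝ) (p j : ℕ) :
    ∑ S ∈ (Finset.range p).powersetCard j,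
        (∏ s ∈ S, d s) * ∏ t ∈ Finset.range (p + 1) \ S, c t =
      c p * mixedEsymm c d p j := by
  rw [mixedEsymm, Finset.mul_sum]
  refine Finset.sum_congr rfl fun S hS => ?_
  have hp : p ∉ S := fun h =>
    Finset.notMem_range_self ((Finset.mem_powersetCard.1 hS).1 h)
  rw [Finset.range_add_one, Finset.insert_sdiff_of_notMem _ hp, Finset.prod_insert (by simp)]
  ring

lemma mixedEsymm_succ_zero (c d : ℕ → ℝ) (p : ℕ) :
    mixedEsymm c d (p + 1) 0 = c p * mixedEsymm c d p 0 := by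
  rw [← sum_powersetCard_range_prod_sdiff_range_succ]
  simp [mixedEsymm]

lemma mixedEsymm_succ_succ (c d : ℕ → ℝ) (p j : ℕ) :
    mixedEsymm c d (p + 1) (j + 1) =
      c p * mixedEsymm c d p (j + 1) + d p * mixedEsymm c d p j := by
  have hp {S : Finset ℕ} {j : ℕ} (hS : S ∈ (Finset.range p).powersetCard j) : p ∉ S := fun h =>
    Finset.notMem_range_self ((Finset.mem_powersetCard.1 hS).1 h)
  rw [← sum_powersetCard_range_prod_sdiff_range_succ, mixedEsymm]
  conv_lhs => enter [1]; rw [Finset.range_add_one]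
  rw [Finset.powersetCard_succ_insert Finset.notMem_range_self, Finset.sum_union, Finset.sum_image]
  · congr 1
    rw [mixedEsymm, Finset.mul_sum]
    refine Finset.sum_congr rfl fun S hS => ?_
    rw [Finset.prod_insert (hp hS), Finset.range_add_one, Finset.insert_sdiff_insert,
      Finset.sdiff_insert_of_notMem Finset.notMem_range_self, mul_assoc]
  · intro S hS T hT h
    rw [← Finset.erase_insert (hp hS), ← Finset.erase_insert (hp hT), h]
  · refine Finset.disjoint_left.2 fun S hS hS' => ?_
    obtain ⟨T, -, rfl⟩ := Finset.mem_image.1 hS'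
    exact hp hS (Finset.mem_insert_self _ _)

/-- The coefficient of `x ^ p` in the transform of `∏_j (c j * x - d j * i + e j)`, with `r = a - b`. -/
noncomputable def leadingValue (c d : ℕ → ℝ) (k p : ℕ) (r : ℝ) : ℝ :=
  ∑ j ∈ Finset.range (k + 1),
    ((k.factorial : ℝ) / ((k - j).factorial : ℝ)) * mixedEsymm c d p j *
      ∏ i ∈ Finset.range (k - j), (r + (j : ℝ) + (i : ℝ))

lemma leadingValue_zero_right (c d : ℕ → ℝ) (k : ℕ) (r : ℝ) :
    leadingValue c d k 0 r = ∏ i ∈ Finset.range k, (r + (i : ℝ)) := by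
  have h (j : ℕ) : mixedEsymm c d 0 (j + 1) = 0 := by
    rw [mixedEsymm, Finset.powersetCard_eq_empty.2 (by simp), Finset.sum_empty]
  have h0 : mixedEsymm c d 0 0 = 1 := by simp [mixedEsymm]
  have hk : (k.factorial : ℝ) ≠ 0 := by positivity
  simp [leadingValue, Finset.sum_range_succ', h, h0, hk]

lemma leadingValue_zero_succ (c d : ℕ → ℝ) (p : ℕ) (r : ℝ) :
    leadingValue c d 0 (p + 1) r = c p * leadingValue c d 0 p r := by
  simp [leadingValue, mixedEsymm_succ_zero]

lemma leadingValue_succ_succ (c d : ℕ → ℝ) (k p : ℕ) (r : ℝ) :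
    leadingValue c d (k + 1) (p + 1) r =
      c p * leadingValue c d (k + 1) p r + d p * ((k + 1) * leadingValue c d k p (r + 1)) := by
  simp only [leadingValue]
  rw [Finset.sum_range_succ', Finset.sum_range_succ' _ (k + 1)]
  simp only [mixedEsymm_succ_succ, mixedEsymm_succ_zero, mul_add, add_mul,
    Finset.sum_add_distrib, Finset.mul_sum]
  have h : ∑ j ∈ Finset.range (k + 1),
      (((k + 1).factorial : ℝ) / ((k + 1 - (j + 1)).factorial : ℝ)) *
          (d p * mixedEsymm c d p j) *
        ∏ i ∈ Finset.range (k + 1 - (j + 1)), (r + ((j + 1 : ℕ) : ℝ) + (i : ℝ)) =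
      ∑ j ∈ Finset.range (k + 1), d p * ((k + 1) * (((k.factorial : ℝ) /
        ((k - j).factorial : ℝ)) * mixedEsymm c d p j *
          ∏ i ∈ Finset.range (k - j), (r + 1 + (j : ℝ) + (i : ℝ)))) := by
    refine Finset.sum_congr rfl fun j _ => ?_
    rw [Nat.add_sub_add_right, Nat.factorial_succ]
    have hprod : ∏ i ∈ Finset.range (k - j), (r + ((j + 1 : ℕ) : ℝ) + (i : ℝ)) =
        ∏ i ∈ Finset.range (k - j), (r + 1 + (j : ℝ) + (i : ℝ)) :=
      Finset.prod_congr rfl fun i _ => by push_cast; ring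
    rw [hprod]
    push_cast
    ring
  rw [h]
  have h' : ∀ j, (((k + 1).factorial : ℝ) / ((k + 1 - (j + 1)).factorial : ℝ)) *
          (c p * mixedEsymm c d p (j + 1)) *
        ∏ i ∈ Finset.range (k + 1 - (j + 1)), (r + ((j + 1 : ℕ) : ℝ) + (i : ℝ)) =
      c p * ((((k + 1).factorial : ℝ) / ((k + 1 - (j + 1)).factorial : ℝ)) *
          mixedEsymm c d p (j + 1) *
        ∏ i ∈ Finset.range (k + 1 - (j + 1)), (r + ((j + 1 : ℕ) : ℝ) + (i : ℝ))) :=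
    fun j => by ring
  simp only [h', add_mul, mul_add, one_mul, Finset.sum_add_distrib]
  ring

lemma Ttilde_eq_sum (k : ℕ) (a b : ℝ) (g : ℕ → ℝ[X]) :
    Ttilde k a b g =
      ∑ i ∈ Finset.range (k + 1), (k.choose i : ℝ[X]) * ((-1) ^ i * (PikPoly i k a b * g i)) := by
  rw [Ttilde, Finset.mul_sum]
  refine Finset.sum_congr rfl fun i hi => ?_
  obtain ⟨m, rfl⟩ := Nat.exists_eq_add_of_le (Nat.lt_succ_iff.1 (Finset.mem_range.1 hi))
  have hm : ((-1 : ℝ[X]) ^ m) * (-1) ^ m = 1 := by rw [← mul_pow]; simp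
  rw [Nat.add_sub_cancel_left]
  simp only [map_mul, map_pow, map_neg, map_one, map_natCast, pow_add]
  linear_combination ((-1) ^ i * ((i + m).choose i : ℝ[X]) * (PikPoly i (i + m) a b * g i)) * hm

lemma PikPoly_succ_of_le {i k : ℕ} (h : i ≤ k) (a b : ℝ) :
    PikPoly i (k + 1) a b = (X + C ((k : ℝ) - i + a)) * PikPoly i k a b := by
  rw [PikPoly, PikPoly, Nat.succ_sub h, Finset.prod_range_succ, Nat.cast_sub h]
  ring

lemma PikPoly_succ_succ (i k : ℕ) (a b : ℝ) :
    PikPoly (i + 1) (k + 1) a b = (X + C (b - i)) * PikPoly i k a b := by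
  rw [PikPoly, PikPoly, Nat.add_sub_add_right, Finset.prod_range_succ]
  ring

lemma PikPoly_succ_succ_sub_one (i k : ℕ) (a b : ℝ) :
    PikPoly (i + 1) (k + 1) a b = (X + C b) * PikPoly i k a (b - 1) := by
  rw [PikPoly, PikPoly, Nat.add_sub_add_right, Finset.prod_range_succ']
  have h (j : ℕ) : b - ((j + 1 : ℕ) : ℝ) = b - 1 - j := by push_cast; ring
  simp only [h, Nat.cast_zero, sub_zero]
  ring

lemma Ttilde_one (k : ℕ) (a b : ℝ) :
    Ttilde k a b (fun _ => 1) = C (∏ i ∈ Finset.range k, (a - b + (i : ℝ))) := by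
  induction k with
  | zero => simp [Ttilde, PikPoly]
  | succ k ih =>
    rw [Finset.prod_range_succ, C_mul, ← ih, Ttilde_eq_sum, Ttilde_eq_sum,
      Finset.sum_choose_succ_mul
        (fun i _ => (-1) ^ i * (PikPoly i (k + 1) a b * 1)), ← Finset.sum_add_distrib,
      Finset.sum_mul]
    refine Finset.sum_congr rfl fun i hi => ?_
    rw [PikPoly_succ_of_le (Nat.lt_succ_iff.1 (Finset.mem_range.1 hi)), PikPoly_succ_succ]
    simp only [C_add, C_sub]
    ring

lemma Ttilde_linear_mul (k : ℕ) (a b u v w : ℝ) (g : ℕ → ℝ[X]) :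
    Ttilde k a b (fun i => g i * (C u * X + C (v - w * (i : ℝ)))) =
      (C u * X + C v) * Ttilde k a b g - C w * Ttilde k a b (fun i => (i : ℝ[X]) * g i) := by
  simp only [Ttilde_eq_sum, Finset.mul_sum, ← Finset.sum_sub_distrib]
  refine Finset.sum_congr rfl fun i _ => ?_
  simp only [C_sub, C_mul, map_natCast]
  ring

lemma Ttilde_succ_natCast_mul (k : ℕ) (a b : ℝ) (g : ℕ → ℝ[X]) :
    Ttilde (k + 1) a b (fun i => (i : ℝ[X]) * g i) =
      -(C ((k : ℝ) + 1) * ((X + C b) * Ttilde k a (b - 1) (fun i => g (i + 1)))) := by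
  rw [Ttilde_eq_sum, Ttilde_eq_sum, Finset.sum_range_succ']
  simp only [Finset.mul_sum, ← Finset.sum_neg_distrib, Nat.cast_zero, zero_mul, mul_zero, add_zero]
  refine Finset.sum_congr rfl fun i _ => ?_
  have h : ((k + 1 : ℕ) : ℝ[X]) * (k.choose i : ℝ[X]) =
      ((k + 1).choose (i + 1) : ℝ[X]) * ((i + 1 : ℕ) : ℝ[X]) := by
    exact_mod_cast congrArg (Nat.cast : ℕ → ℝ[X]) (Nat.add_one_mul_choose_eq k i)
  have hk : C ((k : ℝ) + 1) = ((k + 1 : ℕ) : ℝ[X]) := by simp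
  rw [PikPoly_succ_succ_sub_one, hk, pow_succ]
  linear_combination ((-1) ^ i * ((X + C b) * PikPoly i k a (b - 1) * g (i + 1))) * h

lemma coeff_linear_mul_of_natDegree_le {q : ℝ[X]} {p : ℕ} (hq : q.natDegree ≤ p) (u v : ℝ) :
    ((C u * X + C v) * q).coeff (p + 1) = u * q.coeff p := by
  rw [add_mul, mul_assoc, coeff_add, coeff_C_mul, coeff_X_mul, coeff_C_mul,
    coeff_eq_zero_of_natDegree_lt (Nat.lt_succ_of_le hq)]
  ring

lemma natDegree_linear_mul_le {q : ℝ[X]} {p : ℕ} (hq : q.natDegree ≤ p) (u v : ℝ) :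
    ((C u * X + C v) * q).natDegree ≤ p + 1 := by
  rw [add_comm p]
  exact natDegree_mul_le_of_le natDegree_linear_le hq

lemma natDegree_le_and_coeff_Ttilde_linear_factors (c d : ℕ → ℝ) (p : ℕ) :
    ∀ (k : ℕ) (a b : ℝ) (e : ℕ → ℝ),
      (Ttilde k a b (fun i =>
        ∏ j ∈ Finset.range p, (C (c j) * X + C (e j - d j * (i : ℝ))))).natDegree ≤ p ∧
      (Ttilde k a b (fun i =>
        ∏ j ∈ Finset.range p, (C (c j) * X + C (e j - d j * (i : ℝ))))).coeff p =
          leadingValue c d k p (a - b) := by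
  induction p with
  | zero =>
    intro k a b e
    simp only [Finset.range_zero, Finset.prod_empty, Ttilde_one, leadingValue_zero_right]
    exact ⟨natDegree_C _ |>.le, coeff_C_zero⟩
  | succ p ih =>
    intro k a b e
    simp only [Finset.prod_range_succ, Ttilde_linear_mul]
    obtain ⟨hdeg, hcoeff⟩ := ih k a b e
    cases k with
    | zero =>
      have h0 (g : ℕ → ℝ[X]) : Ttilde 0 a b (fun i => (i : ℝ[X]) * g i) = 0 := by
        simp [Ttilde]
      rw [h0, mul_zero, sub_zero, coeff_linear_mul_of_natDegree_le hdeg, hcoeff,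
        leadingValue_zero_succ]
      exact ⟨natDegree_linear_mul_le hdeg _ _, rfl⟩
    | succ k =>
      have hshift (i j : ℕ) : e j - d j * ((i + 1 : ℕ) : ℝ) = e j - d j - d j * (i : ℝ) := by
        push_cast; ring
      obtain ⟨hdeg', hcoeff'⟩ := ih k a (b - 1) (fun j => e j - d j)
      rw [Ttilde_succ_natCast_mul]
      simp only [hshift]
      have hX : (X + C b : ℝ[X]) = C 1 * X + C b := by simp
      rw [mul_neg, sub_neg_eq_add, hX]
      refine ⟨natDegree_add_le_of_degree_le (natDegree_linear_mul_le hdeg _ _)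
        ((natDegree_C_mul_le _ _).trans ((natDegree_C_mul_le _ _).trans
          (natDegree_linear_mul_le hdeg' _ _))), ?_⟩
      rw [coeff_add, coeff_C_mul, coeff_C_mul, coeff_linear_mul_of_natDegree_le hdeg,
        coeff_linear_mul_of_natDegree_le hdeg', hcoeff, hcoeff', leadingValue_succ_succ, one_mul,
        show a - (b - 1) = a - b + 1 by ring]

theorem leading_coeff_Ttilde_linear_factors (k p : ℕ) (a b : ℝ)
    (c d e : ℕ → ℝ) :
    (Ttilde k a b (fun i =>
        ∏ j ∈ Finset.range p,
          (Polynomial.C (c j) * Polynomial.X +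
            Polynomial.C (e j - d j * (i : ℝ))))).coeff p =
      ∑ j ∈ Finset.range (k + 1),
        ((k.factorial : ℝ) / ((k - j).factorial : ℝ)) *
          (∑ S ∈ (Finset.range p).powersetCard j,
            (∏ s ∈ S, d s) * ∏ t ∈ Finset.range p \ S, c t) *
          ∏ i ∈ Finset.range (k - j), (a - b + (j : ℝ) + (i : ℝ)) := by
  exact (natDegree_le_and_coeff_Ttilde_linear_factors c d p k a b e).2
end

section
/- Let k and p be natural numbers and let a, b, α_1, β_1, α_2, β_2 be real numbers. For each natural number i set F_i(x) := ∏_{j=0}^{p−1} (α_1·x + j − i + β_1)(α_2·x + j − i + β_2). Then the coefficient of x^{2p} in T̃_k^{a,b}[(F_i)_{0≤i≤k}] equals Σ_{j=0}^{k} (k!/(k−j)!) · ( Σ_{i=0}^{p} binom(p,i) · binom(p, 2p−j−i) · α_1^i · α_2^{2p−i−j} ) · ∏_{i'=0}^{k−j−1} (a−b+j+i'), where binom(p,m) is understood to be 0 when m < 0 or m > p (so only pairs (i,j) with 0 ≤ 2p−j−i ≤ p contribute, and in particular the result does not depend on β_1 or β_2). -/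
open Finset Polynomial

lemma Ttilde_eq_sum_choose (k : ℕ) (a b : ℝ) (g : ℕ → ℝ[X]) :
    Ttilde k a b g = ∑ i ∈ range (k + 1),
      (k.choose i : ℝ[X]) * ((-1) ^ i * (PikPoly i k a b * g i)) := by
  rw [Ttilde, mul_sum]
  refine sum_congr rfl fun i hi => ?_
  obtain ⟨m, rfl⟩ := Nat.exists_eq_add_of_le (Nat.lt_succ_iff.mp (mem_range.mp hi))
  have hs : ((-1 : ℝ[X]) ^ m) * (-1) ^ m = 1 := by rw [← mul_pow]; simp
  simp only [add_tsub_cancel_left, map_mul, map_pow, map_neg, map_one, map_natCast, pow_add]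
  linear_combination (((i + m).choose i : ℝ[X]) * ((-1) ^ i * (PikPoly i (i + m) a b * g i))) * hs

lemma Ttilde_succ (k : ℕ) (a b : ℝ) (g : ℕ → ℝ[X]) :
    Ttilde (k + 1) a b g = Ttilde k a b fun i =>
      (X + C ((k : ℝ) - i + a)) * g i - (X + C (b - i)) * g (i + 1) := by
  rw [Ttilde_eq_sum_choose, Ttilde_eq_sum_choose,
    sum_choose_succ_mul (fun i _ => (-1 : ℝ[X]) ^ i * (PikPoly i (k + 1) a b * g i)) k,
    ← sum_add_distrib]
  refine sum_congr rfl fun i hi => ?_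
  have hik : i ≤ k := Nat.lt_succ_iff.mp (mem_range.mp hi)
  have h₁ : PikPoly i (k + 1) a b = PikPoly i k a b * (X + C ((k : ℝ) - i + a)) := by
    rw [PikPoly, PikPoly, Nat.succ_sub hik, prod_range_succ, Nat.cast_sub hik]
    ring
  have h₂ : PikPoly (i + 1) (k + 1) a b = PikPoly i k a b * (X + C (b - i)) := by
    rw [PikPoly, PikPoly, Nat.add_sub_add_right, prod_range_succ]
    ring
  rw [h₁, h₂]
  ring

lemma Ttilde_sum_mul {ι : Type*} (s : Finset ι) (k : ℕ) (a b : ℝ) (h : ι → ℝ[X])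
    (g : ι → ℕ → ℝ[X]) :
    Ttilde k a b (fun i => ∑ j ∈ s, h j * g j i) = ∑ j ∈ s, h j * Ttilde k a b (g j) := by
  simp only [Ttilde_eq_sum_choose, mul_sum]
  rw [sum_comm]
  refine sum_congr rfl fun j _ => sum_congr rfl fun i _ => ?_
  ring

lemma Ttilde_add (k : ℕ) (a b : ℝ) (g h : ℕ → ℝ[X]) :
    Ttilde k a b (fun i => g i + h i) = Ttilde k a b g + Ttilde k a b h := by
  simp only [Ttilde_eq_sum_choose, mul_add, sum_add_distrib]

lemma Ttilde_mul_left (k : ℕ) (a b : ℝ) (q : ℝ[X]) (g : ℕ → ℝ[X]) :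
    Ttilde k a b (fun i => q * g i) = q * Ttilde k a b g := by
  simpa using Ttilde_sum_mul {()} k a b (fun _ => q) (fun _ => g)

/-- The transform of the family of constants `i ↦ i ^ j` satisfies a recursion in `k`. -/
lemma Ttilde_succ_pow (k j : ℕ) (a b : ℝ) :
    Ttilde (k + 1) a b (fun i => (i : ℝ[X]) ^ j) =
      C ((k : ℝ) + a - b) * Ttilde k a b (fun i => (i : ℝ[X]) ^ j) +
        ∑ m ∈ range j, (j.choose m : ℝ[X]) *
          (Ttilde k a b (fun i => (i : ℝ[X]) ^ (m + 1)) -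
            (X + C b) * Ttilde k a b (fun i => (i : ℝ[X]) ^ m)) := by
  have hfam : ∀ i : ℕ, (X + C ((k : ℝ) - i + a)) * (i : ℝ[X]) ^ j -
      (X + C (b - i)) * ((i + 1 : ℕ) : ℝ[X]) ^ j =
      C ((k : ℝ) + a - b) * (i : ℝ[X]) ^ j +
        ∑ m ∈ range j, (j.choose m : ℝ[X]) *
          ((i : ℝ[X]) ^ (m + 1) + (-(X + C b)) * (i : ℝ[X]) ^ m) := by
    intro i
    have hsum : ∑ m ∈ range j, (j.choose m : ℝ[X]) *
        ((i : ℝ[X]) ^ (m + 1) + (-(X + C b)) * (i : ℝ[X]) ^ m) =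
        ((i : ℝ[X]) - X - C b) * ∑ m ∈ range j, (i : ℝ[X]) ^ m * (j.choose m : ℝ[X]) := by
      rw [mul_sum]
      exact sum_congr rfl fun m _ => by ring
    have hpow := add_pow (i : ℝ[X]) 1 j
    rw [sum_range_succ] at hpow
    simp only [one_pow, mul_one, Nat.choose_self, Nat.cast_one] at hpow
    rw [hsum]
    push_cast
    rw [hpow]
    simp only [map_add, map_sub, map_natCast]
    ring
  rw [Ttilde_succ]
  simp only [hfam]
  rw [Ttilde_add, Ttilde_mul_left, Ttilde_sum_mul]
  simp only [Ttilde_add, Ttilde_mul_left]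
  congr 1
  exact sum_congr rfl fun m _ => by ring

/-- The coefficient of `x ^ j` in the transform of the family of constants `i ↦ i ^ j`, with
`c = a - b`. -/
noncomputable def powTopCoeff (c : ℝ) (k j : ℕ) : ℝ :=
  (-1) ^ j * (k.descFactorial j : ℝ) * ∏ i ∈ range (k - j), (c + j + i)

lemma powTopCoeff_of_lt (c : ℝ) {k j : ℕ} (h : k < j) : powTopCoeff c k j = 0 := by
  simp [powTopCoeff, Nat.descFactorial_of_lt h]

lemma powTopCoeff_succ_zero (c : ℝ) (k : ℕ) :
    powTopCoeff c (k + 1) 0 = (k + c) * powTopCoeff c k 0 := by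
  simp [powTopCoeff, prod_range_succ]
  ring

lemma powTopCoeff_succ_succ (c : ℝ) (k j : ℕ) :
    powTopCoeff c (k + 1) (j + 1) = (k + c) * powTopCoeff c k (j + 1) +
      (j + 1) * (powTopCoeff c k (j + 1) - powTopCoeff c k j) := by
  rcases lt_trichotomy k j with h | rfl | h
  · simp [powTopCoeff_of_lt, h, h.trans (Nat.lt_succ_self j)]
  · rw [powTopCoeff_of_lt c (Nat.lt_succ_self k)]
    simp only [powTopCoeff, tsub_self, range_zero, prod_empty, Nat.descFactorial_self,
      Nat.factorial_succ]
    push_cast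
    ring
  · obtain ⟨m, rfl⟩ := Nat.exists_eq_add_of_lt h
    have h₁ : j + m + 1 + 1 - (j + 1) = m + 1 := by omega
    have h₂ : j + m + 1 - (j + 1) = m := by omega
    have h₃ : j + m + 1 - j = m + 1 := by omega
    have hprod : ∏ i ∈ range (m + 1), (c + (j : ℝ) + (i : ℝ)) =
        (∏ i ∈ range m, (c + ((j + 1 : ℕ) : ℝ) + (i : ℝ))) * (c + j) := by
      rw [prod_range_succ']
      push_cast
      congr 1
      · exact prod_congr rfl fun i _ => by ring
      · ring
    simp only [powTopCoeff]
    rw [h₁, h₂, h₃, hprod, Nat.succ_descFactorial_succ, Nat.descFactorial_succ, h₃,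
      prod_range_succ]
    push_cast
    ring

lemma coeff_Ttilde_pow (a b : ℝ) (k : ℕ) : ∀ j n : ℕ, j ≤ n →
    (Ttilde k a b (fun i => (i : ℝ[X]) ^ j)).coeff n =
      if n = j then powTopCoeff (a - b) k j else 0 := by
  induction k with
  | zero =>
    intro j n hjn
    rcases j with _ | j
    · simp [Ttilde, PikPoly, powTopCoeff, coeff_one]
    · simp [Ttilde, PikPoly, powTopCoeff]
  | succ k ih =>
    intro j n hjn
    have hterm : ∀ m ∈ range j, ((j.choose m : ℝ[X]) *
        (Ttilde k a b (fun i => (i : ℝ[X]) ^ (m + 1)) -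
          (X + C b) * Ttilde k a b (fun i => (i : ℝ[X]) ^ m))).coeff n =
        if n = m + 1 then (j.choose m : ℝ) *
          (powTopCoeff (a - b) k (m + 1) - powTopCoeff (a - b) k m) else 0 := by
      intro m hm
      have hmj := mem_range.mp hm
      obtain ⟨n, rfl⟩ := Nat.exists_eq_succ_of_ne_zero (by omega : n ≠ 0)
      rw [← C_eq_natCast, coeff_C_mul, coeff_sub, add_mul, coeff_add, coeff_X_mul, coeff_C_mul,
        ih (m + 1) _ (by omega), ih m n (by omega), ih m (n + 1) (by omega),
        if_neg (by omega : ¬ n + 1 = m)]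
      by_cases h : n = m <;> simp [h]
    rw [Ttilde_succ_pow, coeff_add, coeff_C_mul, ih j n hjn, finsetSum_coeff,
      sum_congr rfl hterm]
    rcases j with _ | j
    · simp only [range_zero, sum_empty, add_zero, powTopCoeff_succ_zero]
      split_ifs <;> ring
    · rw [sum_range_succ, sum_eq_zero fun m hm => if_neg (by have := mem_range.mp hm; omega)]
      simp only [powTopCoeff_succ_succ, Nat.choose_succ_self_right]
      push_cast
      split_ifs <;> ring

/-- `G`, as a polynomial in `x` (inner) and `y` (outer), has total degree at most `d`, and its
homogeneous part of degree `d` dehomogenizes to `q` at `x = 1`. -/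
structure HasTopForm (d : ℕ) (G : ℝ[X][X]) (q : ℝ[X]) : Prop where
  coeff_coeff_of_lt : ∀ j n, d < j + n → (G.coeff j).coeff n = 0
  coeff_coeff_of_eq : ∀ j n, j + n = d → (G.coeff j).coeff n = q.coeff j
  coeff_of_lt : ∀ j, d < j → q.coeff j = 0

lemma hasTopForm_one : HasTopForm 0 1 1 where
  coeff_coeff_of_lt j n h := by
    rcases j with _ | j
    · simp [coeff_one, show n ≠ 0 by omega]
    · simp [coeff_one]
  coeff_coeff_of_eq j n h := by
    obtain ⟨rfl, rfl⟩ : j = 0 ∧ n = 0 := by omega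
    simp
  coeff_of_lt j h := by simp [coeff_one, h.ne']

lemma HasTopForm.linear_mul {d : ℕ} {G : ℝ[X][X]} {q : ℝ[X]} (h : HasTopForm d G q) (α β : ℝ) :
    HasTopForm (d + 1) ((C (C α * X + C β) - X) * G) ((C α - X) * q) where
  coeff_coeff_of_lt j n hjn := by
    have hj := h.coeff_coeff_of_lt
    rcases j with _ | j <;> rcases n with _ | n <;>
      simp (disch := omega) [sub_mul, add_mul, mul_assoc, coeff_X_mul, hj]
  coeff_coeff_of_eq j n hjn := by
    have hj := h.coeff_coeff_of_lt
    have he := h.coeff_coeff_of_eq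
    have hq := h.coeff_of_lt
    rcases j with _ | j <;> rcases n with _ | n <;>
      simp (disch := omega) [sub_mul, add_mul, mul_assoc, coeff_X_mul, hj, he, hq]
  coeff_of_lt j hj := by
    have hq := h.coeff_of_lt
    obtain ⟨j, rfl⟩ := Nat.exists_eq_succ_of_ne_zero (by omega : j ≠ 0)
    simp (disch := omega) [sub_mul, coeff_X_mul, hq]

lemma HasTopForm.coeff_Ttilde {d : ℕ} {G : ℝ[X][X]} {q : ℝ[X]} (h : HasTopForm d G q)
    (k : ℕ) (a b : ℝ) :
    (Ttilde k a b (fun i => G.eval (i : ℝ[X]))).coeff d =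
      ∑ j ∈ range (d + 1), q.coeff j * powTopCoeff (a - b) k j := by
  have hG : G.natDegree < d + 1 := by
    refine Nat.lt_succ_iff.mpr (natDegree_le_iff_coeff_eq_zero.mpr fun j hj => ?_)
    ext n
    simpa using h.coeff_coeff_of_lt j n (by omega)
  simp only [eval_eq_sum_range' hG]
  rw [Ttilde_sum_mul, finsetSum_coeff]
  refine sum_congr rfl fun j hj => ?_
  obtain ⟨n, rfl⟩ := Nat.exists_eq_add_of_le (Nat.lt_succ_iff.mp (mem_range.mp hj))
  have hn : (G.coeff j).natDegree ≤ n :=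
    natDegree_le_iff_coeff_eq_zero.mpr fun m hm => h.coeff_coeff_of_lt j m (by omega)
  have ht : (Ttilde k a b (fun i => (i : ℝ[X]) ^ j)).natDegree ≤ j :=
    natDegree_le_iff_coeff_eq_zero.mpr fun m hm => by
      rw [coeff_Ttilde_pow a b k j m hm.le, if_neg hm.ne']
  rw [add_comm j n, coeff_mul_add_eq_of_natDegree_le hn ht, h.coeff_coeff_of_eq j n rfl,
    coeff_Ttilde_pow a b k j j le_rfl, if_pos rfl]

lemma hasTopForm_prod (p : ℕ) (α₁ β₁ α₂ β₂ : ℝ) :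
    HasTopForm (2 * p)
      (∏ j ∈ range p, ((C (C α₁ * X + C ((j : ℝ) + β₁)) - X) *
        (C (C α₂ * X + C ((j : ℝ) + β₂)) - X)))
      ((C α₁ - X) ^ p * (C α₂ - X) ^ p) := by
  induction p with
  | zero => simpa using hasTopForm_one
  | succ p ih =>
    convert (ih.linear_mul α₂ (p + β₂)).linear_mul α₁ (p + β₁) using 1
    · ring
    · rw [prod_range_succ]
      ring
    · ring

lemma coeff_C_sub_X_pow (α : ℝ) (p n : ℕ) :
    ((C α - X) ^ p).coeff n = (-1) ^ n * (p.choose n : ℝ) * α ^ (p - n) := by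
  have h : (C α - X) ^ p = ((X + C α) ^ p).comp (C (-1) * X) := by
    simp [sub_eq_neg_add]
  rw [h, comp_C_mul_X_coeff, coeff_X_add_C_pow]
  ring

lemma coeff_C_sub_X_pow_mul (α₁ α₂ : ℝ) (p j : ℕ) :
    ((C α₁ - X) ^ p * (C α₂ - X) ^ p).coeff j = (-1) ^ j *
      ∑ i ∈ range (p + 1),
        (if i + j ≤ 2 * p then
          (p.choose i : ℝ) * (p.choose (2 * p - j - i) : ℝ) * α₁ ^ i * α₂ ^ (2 * p - i - j)
        else 0) := by
  have h : (C α₁ - X) ^ p = ∑ i ∈ range (p + 1),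
      C (α₁ ^ i * (-1) ^ (p - i) * (p.choose i : ℝ)) * X ^ (p - i) := by
    rw [sub_eq_add_neg, add_pow]
    refine sum_congr rfl fun i _ => ?_
    rw [neg_pow (X : ℝ[X])]
    simp only [map_mul, map_pow, map_neg, map_one, map_natCast]
    ring
  rw [h, sum_mul, finsetSum_coeff, mul_sum]
  refine sum_congr rfl fun i hi => ?_
  have hip : i ≤ p := Nat.lt_succ_iff.mp (mem_range.mp hi)
  rw [mul_assoc, coeff_C_mul, coeff_X_pow_mul', coeff_C_sub_X_pow]
  by_cases h₁ : p - i ≤ j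
  · rw [if_pos h₁]
    obtain ⟨n, rfl⟩ := Nat.exists_eq_add_of_le h₁
    rw [add_tsub_cancel_left]
    by_cases h₂ : n ≤ p
    · rw [if_pos (by omega), show 2 * p - (p - i + n) - i = p - n by omega,
        show 2 * p - i - (p - i + n) = p - n by omega, Nat.choose_symm h₂]
      ring
    · rw [if_neg (by omega), Nat.choose_eq_zero_of_lt (by omega : p < n)]
      simp
  · rw [if_neg h₁, if_pos (by omega),
      Nat.choose_eq_zero_of_lt (by omega : p < 2 * p - j - i)]
    simp

theorem coeff_Ttilde_F (k p : ℕ) (a b α₁ β₁ α₂ β₂ : ℝ) :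
    (Ttilde k a b (fun i =>
        ∏ j ∈ Finset.range p,
          ((Polynomial.C α₁ * Polynomial.X + Polynomial.C ((j : ℝ) - (i : ℝ) + β₁)) *
            (Polynomial.C α₂ * Polynomial.X + Polynomial.C ((j : ℝ) - (i : ℝ) + β₂))))).coeff
        (2 * p) =
      ∑ j ∈ Finset.range (k + 1),
        ((k.factorial : ℝ) / ((k - j).factorial : ℝ)) *
          (∑ i ∈ Finset.range (p + 1),
            (if i + j ≤ 2 * p then
              (p.choose i : ℝ) * (p.choose (2 * p - j - i) : ℝ) *
                α₁ ^ i * α₂ ^ (2 * p - i - j)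
            else 0)) *
          ∏ i' ∈ Finset.range (k - j), (a - b + (j : ℝ) + (i' : ℝ)) := by
  have hF : ∀ i : ℕ, ∏ j ∈ range p, ((C α₁ * X + C ((j : ℝ) - (i : ℝ) + β₁)) *
      (C α₂ * X + C ((j : ℝ) - (i : ℝ) + β₂))) =
      (∏ j ∈ range p, ((C (C α₁ * X + C ((j : ℝ) + β₁)) - X) *
        (C (C α₂ * X + C ((j : ℝ) + β₂)) - X))).eval (i : ℝ[X]) := by
    intro i
    rw [eval_prod]
    refine prod_congr rfl fun j _ => ?_
    simp only [eval_mul, eval_sub, eval_C, eval_X]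
    simp only [map_add, map_sub, map_natCast]
    ring
  simp only [hF]
  rw [(hasTopForm_prod p α₁ β₁ α₂ β₂).coeff_Ttilde]
  have hq := (hasTopForm_prod p α₁ β₁ α₂ β₂).coeff_of_lt
  set q := (C α₁ - X) ^ p * (C α₂ - X) ^ p with hq_def
  trans ∑ j ∈ range (k + 1), q.coeff j * powTopCoeff (a - b) k j
  · rcases le_total k (2 * p) with h | h
    · refine (sum_subset (range_mono (by omega)) fun j _ hj => ?_).symm
      rw [powTopCoeff_of_lt _ (by simpa using hj), mul_zero]
    · refine sum_subset (range_mono (by omega)) fun j _ hj => ?_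
      rw [hq j (by simpa using hj), zero_mul]
  · refine sum_congr rfl fun j hj => ?_
    have hjk : j ≤ k := Nat.lt_succ_iff.mp (mem_range.mp hj)
    have hs : ((-1 : ℝ) ^ j) * (-1) ^ j = 1 := by rw [← mul_pow]; simp
    have hfac : (k.factorial : ℝ) / ((k - j).factorial : ℝ) = (k.descFactorial j : ℝ) := by
      rw [div_eq_iff (by positivity), ← Nat.factorial_mul_descFactorial hjk]
      push_cast
      ring
    rw [hq_def, coeff_C_sub_X_pow_mul, powTopCoeff, hfac]
    generalize (∑ i ∈ range (p + 1), _ : ℝ) = s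
    generalize (∏ i ∈ range (k - j), _ : ℝ) = t
    linear_combination s * (k.descFactorial j : ℝ) * t * hs
end

section
/- Let k ≥ 1 be a natural number and let a_1, a_0, b_1, b_0 be real numbers; write a(x) := a_1·x + a_0 and b(x) := b_1·x + b_0. Define the real polynomial N_k(x) := Σ_{i=0}^{k−1} (−1)^i · binom(k−1,i) · ∏_{j=−k+1}^{−i−1} (2x + a(x) + b(x) + j − 2) · ∏_{j=−i}^{k−1−i} (x+j)(x + a(x) + j − 1) · ∏_{j=k−i}^{k−1} (2x + a(x) + b(x) + j − 2), where each product is over the indicated range of integers j (empty products equal 1). Then N_k, as a polynomial in x, has degree at most 2k (even though each individual summand has degree up to 3k−1). -/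
open Finset Polynomial

/-- The numerator polynomial `N_k(x)` with `a(x) = a₁x + a₀`, `b(x) = b₁x + b₀`. -/
noncomputable def NkPoly (k : ℕ) (a₁ a₀ b₁ b₀ : ℝ) : Polynomial ℝ :=
  ∑ i ∈ Finset.range k,
    Polynomial.C ((-1 : ℝ) ^ i * ((k - 1).choose i : ℝ)) *
      ((∏ j ∈ Finset.Icc (1 - (k : ℤ)) (-(i : ℤ) - 1),
          (Polynomial.C (2 + a₁ + b₁) * Polynomial.X +
            Polynomial.C (a₀ + b₀ + (j : ℝ) - 2))) *
        (∏ j ∈ Finset.Icc (-(i : ℤ)) ((k : ℤ) - 1 - (i : ℤ)),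
          ((Polynomial.X + Polynomial.C (j : ℝ)) *
            (Polynomial.C (1 + a₁) * Polynomial.X + Polynomial.C (a₀ + (j : ℝ) - 1)))) *
        ∏ j ∈ Finset.Icc ((k : ℤ) - (i : ℤ)) ((k : ℤ) - 1),
          (Polynomial.C (2 + a₁ + b₁) * Polynomial.X +
            Polynomial.C (a₀ + b₀ + (j : ℝ) - 2)))

/-- `HasJointDegreeLE n f` says that `f i` is a polynomial expression in `X` and `i` of total degree
at most `n`, phrased through degrees of iterated forward differences in `i`. -/
def HasJointDegreeLE : ℕ → (ℕ → ℝ[X]) → Prop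
  | 0, f => ∃ c : ℝ, ∀ i, f i = C c
  | n + 1, f => (∀ i, (f i).natDegree ≤ n + 1) ∧ HasJointDegreeLE n fun i => f (i + 1) - f i

namespace HasJointDegreeLE

theorem natDegree_le {n : ℕ} {f : ℕ → ℝ[X]} (hf : HasJointDegreeLE n f) (i : ℕ) :
    (f i).natDegree ≤ n := by
  cases n with
  | zero =>
    obtain ⟨c, hc⟩ := hf
    simp [hc]
  | succ n => exact hf.1 i

theorem add {n : ℕ} {f g : ℕ → ℝ[X]} (hf : HasJointDegreeLE n f) (hg : HasJointDegreeLE n g) :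
    HasJointDegreeLE n fun i => f i + g i := by
  induction n generalizing f g with
  | zero =>
    obtain ⟨c, hc⟩ := hf
    obtain ⟨d, hd⟩ := hg
    exact ⟨c + d, fun i => by simp [hc, hd]⟩
  | succ n ih =>
    refine ⟨fun i => natDegree_add_le_of_degree_le (hf.1 i) (hg.1 i), ?_⟩
    convert ih hf.2 hg.2 using 2
    ring

theorem const_mul {n : ℕ} {f : ℕ → ℝ[X]} (c : ℝ) (hf : HasJointDegreeLE n f) :
    HasJointDegreeLE n fun i => C c * f i := by
  induction n generalizing f with
  | zero =>
    obtain ⟨d, hd⟩ := hf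
    exact ⟨c * d, fun i => by simp [hd]⟩
  | succ n ih =>
    refine ⟨fun i => (natDegree_C_mul_le c (f i)).trans (hf.1 i), ?_⟩
    convert ih hf.2 using 2
    ring

theorem shift {n : ℕ} {f : ℕ → ℝ[X]} (hf : HasJointDegreeLE n f) :
    HasJointDegreeLE n fun i => f (i + 1) := by
  induction n generalizing f with
  | zero =>
    obtain ⟨d, hd⟩ := hf
    exact ⟨d, fun i => hd _⟩
  | succ n ih => exact ⟨fun i => hf.1 _, ih hf.2⟩

theorem linear_mul {n : ℕ} {f : ℕ → ℝ[X]} (α β γ : ℝ) (hf : HasJointDegreeLE n f) :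
    HasJointDegreeLE (n + 1) fun i => (C α * X + C (β * i + γ)) * f i := by
  induction n generalizing f γ with
  | zero =>
    refine ⟨fun i => (natDegree_mul_le_of_le natDegree_linear_le (hf.natDegree_le i)).trans ?_, ?_⟩
    · omega
    · obtain ⟨d, hd⟩ := hf
      refine ⟨β * d, fun i => ?_⟩
      simp only [hd, Nat.cast_add, Nat.cast_one, map_add, map_mul, map_one]
      ring
  | succ n ih =>
    refine ⟨fun i => (natDegree_mul_le_of_le natDegree_linear_le (hf.natDegree_le i)).trans ?_, ?_⟩
    · omega
    · convert (ih (β + γ) hf.2).add (hf.const_mul β) using 2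
      simp only [Nat.cast_add, Nat.cast_one, map_add, map_mul, map_one]
      ring

theorem prod_linear_mul_linear (α γ δ : ℝ) (n : ℕ) :
    HasJointDegreeLE (2 * n) fun i => ∏ l ∈ range n,
      ((X + C ((l : ℝ) - i)) * (C α * X + C (γ + ((l : ℝ) - i) + δ))) := by
  induction n with
  | zero => exact ⟨1, by simp⟩
  | succ n ih =>
    rw [Nat.mul_succ]
    convert (ih.linear_mul α (-1) (γ + n + δ)).linear_mul 1 (-1) n using 2 with i
    simp only [prod_range_succ, map_add, map_sub, map_mul, map_neg, map_one]
    ring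

theorem linear_mul_sub_shift {n : ℕ} {f : ℕ → ℝ[X]} (α β γ δ : ℝ)
    (hf : HasJointDegreeLE n f) :
    HasJointDegreeLE n fun i => (C α * X + C (β * i + γ)) * f i -
      (C α * X + C (β * i + δ)) * f (i + 1) := by
  have key : HasJointDegreeLE n fun i => (C α * X + C (β * i + γ)) * (f (i + 1) - f i) := by
    cases n with
    | zero =>
      obtain ⟨c, hc⟩ := hf
      exact ⟨0, fun i => by simp [hc]⟩
    | succ n => exact hf.2.linear_mul α β γ
  convert (key.const_mul (-1)).add (hf.shift.const_mul (γ - δ)) using 2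
  simp only [map_add, map_sub, map_neg, map_one]
  ring

end HasJointDegreeLE

theorem natDegree_alternating_sum_le {n : ℕ} (α γ δ : ℝ) (m : ℕ) {f : ℕ → ℝ[X]}
    (hf : HasJointDegreeLE n f) :
    (∑ i ∈ range (m + 1), (m.choose i : ℝ[X]) * ((-1) ^ i * f i *
      (∏ s ∈ range (m - i), (C α * X + C (γ + s))) *
      ∏ s ∈ range i, (C α * X + C (δ - s)))).natDegree ≤ n := by
  induction m generalizing f with
  | zero => simpa using hf.natDegree_le 0
  | succ m ih =>
    rw [sum_choose_succ_mul (fun i j => (-1) ^ i * f i *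
      (∏ s ∈ range j, (C α * X + C (γ + s))) * ∏ s ∈ range i, (C α * X + C (δ - s)))]
    rw [← sum_add_distrib]
    convert ih (hf.linear_mul_sub_shift α (-1) (γ + m) δ) using 2
    refine sum_congr rfl fun i hi => ?_
    have him : i ≤ m := by simpa [Nat.lt_succ_iff] using hi
    rw [Nat.sub_add_comm him, prod_range_succ, prod_range_succ, pow_succ, Nat.cast_sub him]
    simp only [map_add, map_sub, map_mul, map_neg, map_one]
    ring

theorem prod_Icc_int_eq_prod_range {M : Type*} [CommMonoid M] (g : ℤ → M) (a b : ℤ) (n : ℕ)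
    (h : b + 1 - a = n) : ∏ j ∈ Icc a b, g j = ∏ s ∈ range n, g (a + s) := by
  obtain rfl : b = a + n - 1 := by omega
  refine (Finset.prod_bij (fun (s : ℕ) _ => a + (s : ℤ)) ?_ ?_ ?_ ?_).symm
  · intro s hs
    simp only [Finset.mem_range, Finset.mem_Icc] at *
    omega
  · intro s _ t _ h
    omega
  · intro j hj
    simp only [Finset.mem_Icc] at hj
    exact ⟨(j - a).toNat, by simp only [Finset.mem_range]; omega, by omega⟩
  · intros
    rfl

theorem degree_NkPoly_le (k : ℕ) (hk : 1 ≤ k) (a₁ a₀ b₁ b₀ : ℝ) :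
    (NkPoly k a₁ a₀ b₁ b₀).degree ≤ (2 * k : ℕ) := by
  obtain ⟨m, rfl⟩ : ∃ m, k = m + 1 := ⟨k - 1, by omega⟩
  refine degree_le_of_natDegree_le ?_
  convert natDegree_alternating_sum_le (2 + a₁ + b₁) (a₀ + b₀ - m - 2) (a₀ + b₀ + m - 2) m
    (HasJointDegreeLE.prod_linear_mul_linear (1 + a₁) a₀ (-1) (m + 1)) using 2
  refine sum_congr rfl fun i hi => ?_
  have him : i ≤ m := by simpa [Nat.lt_succ_iff] using hi
  rw [prod_Icc_int_eq_prod_range _ _ _ (m - i) (by push_cast; omega),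
    prod_Icc_int_eq_prod_range _ _ _ (m + 1) (by push_cast; omega),
    prod_Icc_int_eq_prod_range _ _ _ i (by push_cast; omega),
    ← prod_range_reflect (fun s : ℕ => C (2 + a₁ + b₁) * X + C (a₀ + b₀ + m - 2 - (s : ℝ))) i]
  have h₁ : ∀ s ∈ range (m - i), C (2 + a₁ + b₁) * X +
      C (a₀ + b₀ + ((1 - ((m + 1 : ℕ) : ℤ) + s : ℤ) : ℝ) - 2) =
      C (2 + a₁ + b₁) * X + C (a₀ + b₀ - m - 2 + (s : ℝ)) := by
    intro s _
    push_cast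
    ring_nf
  have h₂ : ∀ s ∈ range (m + 1), (X + C ((-(i : ℤ) + s : ℤ) : ℝ)) *
      (C (1 + a₁) * X + C (a₀ + ((-(i : ℤ) + s : ℤ) : ℝ) - 1)) =
      (X + C ((s : ℝ) - i)) * (C (1 + a₁) * X + C (a₀ + ((s : ℝ) - i) + -1)) := by
    intro s _
    push_cast
    ring_nf
  have h₃ : ∀ s ∈ range i, C (2 + a₁ + b₁) * X +
      C (a₀ + b₀ + ((((m + 1 : ℕ) : ℤ) - i + s : ℤ) : ℝ) - 2) =
      C (2 + a₁ + b₁) * X + C (a₀ + b₀ + m - 2 - ((i - 1 - s : ℕ) : ℝ)) := by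
    intro s hs
    have hsi : s + 1 ≤ i := by simpa [Nat.succ_le_iff] using hs
    rw [show i - 1 - s = i - (s + 1) by omega, Nat.cast_sub hsi]
    push_cast
    ring_nf
  rw [prod_congr rfl h₁, prod_congr rfl h₂, prod_congr rfl h₃]
  simp only [map_mul, map_pow, map_neg, map_one, map_natCast, Nat.add_sub_cancel]
  ring
end

section
/- Let k ≥ 1 be a natural number and let a_1, a_0, b_1, b_0 be real numbers such that a_1·N + a_0 > 0 and b_1·N + b_0 > 0 for every natural number N ≥ 1. Then the sequence N ↦ I_k(N; a_1·N + a_0, b_1·N + b_0)/N converges to a finite limit as N → ∞; that is, there exists L ∈ ℝ such that I_k(N; a_1·N + a_0, b_1·N + b_0)/N → L. -/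
open Finset MeasureTheory

open MvPolynomial

/-- The one-variable Jacobi weight `t ^ (a - 1) * (1 - t) ^ (b - 1)`. -/
noncomputable def jacobiWeight (a b t : ℝ) : ℝ := t ^ (a - 1) * (1 - t) ^ (b - 1)

/-- The `m`-th moment of the Jacobi weight on `[0, 1]`. -/
noncomputable def jacobiMoment (a b : ℝ) (m : ℕ) : ℝ :=
  ∫ t in Set.Icc (0 : ℝ) 1, t ^ m * jacobiWeight a b t

lemma jacobiWeight_nonneg (a b : ℝ) {t : ℝ} (ht : t ∈ Set.Icc (0 : ℝ) 1) :
    0 ≤ jacobiWeight a b t :=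
  mul_nonneg (Real.rpow_nonneg ht.1 _) (Real.rpow_nonneg (sub_nonneg.2 ht.2) _)

lemma jacobiWeight_pos (a b : ℝ) {t : ℝ} (ht : t ∈ Set.Ioo (0 : ℝ) 1) :
    0 < jacobiWeight a b t :=
  mul_pos (Real.rpow_pos_of_pos ht.1 _) (Real.rpow_pos_of_pos (sub_pos.2 ht.2) _)

lemma integrableOn_pow_mul_jacobiWeight {a b : ℝ} (ha : 0 < a) (hb : 0 < b) (m : ℕ) :
    IntegrableOn (fun t => t ^ m * jacobiWeight a b t) (Set.Icc (0 : ℝ) 1) := by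
  have hw : IntegrableOn (jacobiWeight a b) (Set.Icc (0 : ℝ) 1) := by
    have h := (Complex.betaIntegral_convergent (u := a) (v := b) (by simpa) (by simpa)).norm
    rw [intervalIntegrable_iff_integrableOn_Ioo_of_le zero_le_one] at h
    rw [integrableOn_Icc_iff_integrableOn_Ioo]
    refine h.congr_fun (fun t ht => ?_) measurableSet_Ioo
    have h1 : (1 - (t : ℂ)) = ((1 - t : ℝ) : ℂ) := by push_cast; ring
    simp only [norm_mul, jacobiWeight]
    rw [h1, Complex.norm_cpow_eq_rpow_re_of_pos ht.1,
      Complex.norm_cpow_eq_rpow_re_of_pos (sub_pos.2 ht.2)]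
    simp
  exact hw.continuousOn_mul (by fun_prop) isCompact_Icc

/-- Integration by parts for the Jacobi weight. -/
lemma jacobiMoment_succ {a b : ℝ} (ha : 0 < a) (hb : 0 < b) (m : ℕ) :
    (a + m) * jacobiMoment a b m = (a + b + m) * jacobiMoment a b (m + 1) := by
  have hi := fun m => integrableOn_pow_mul_jacobiWeight ha hb m
  have hm : 0 < a + m := by positivity
  have hint : IntegrableOn (fun t => (a + m) * (t ^ m * jacobiWeight a b t)
      - (a + b + m) * (t ^ (m + 1) * jacobiWeight a b t)) (Set.Icc (0 : ℝ) 1) :=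
    ((hi m).const_mul _).sub ((hi (m + 1)).const_mul _)
  have hFTC := intervalIntegral.integral_eq_sub_of_hasDerivAt_of_le (a := 0) (b := 1)
    (f := fun t : ℝ => t ^ (a + m) * (1 - t) ^ b) zero_le_one
    (f' := fun t => (a + m) * (t ^ m * jacobiWeight a b t)
      - (a + b + m) * (t ^ (m + 1) * jacobiWeight a b t))
    (by
      refine ContinuousOn.mul ?_ ?_
      · exact (Real.continuous_rpow_const hm.le).continuousOn
      · exact ((Real.continuous_rpow_const hb.le).comp (by fun_prop)).continuousOn)
    (by
      intro t ht
      have ht0 : 0 < t := ht.1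
      have ht1 : 0 < 1 - t := sub_pos.2 ht.2
      have h1 : HasDerivAt (fun t : ℝ => t ^ (a + m)) ((a + m) * t ^ (a + m - 1)) t :=
        Real.hasDerivAt_rpow_const (Or.inl ht0.ne')
      have h2 : HasDerivAt (fun t : ℝ => (1 - t) ^ b) (-1 * b * (1 - t) ^ (b - 1)) t :=
        ((hasDerivAt_id t).const_sub 1).rpow_const (Or.inl ht1.ne')
      convert! h1.mul h2 using 1
      have e1 : t ^ (a + m - 1) = t ^ m * t ^ (a - 1) := by
        rw [← Real.rpow_natCast, ← Real.rpow_add ht0]; ring_nf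
      have e2 : t ^ (a + m) = t ^ m * t * t ^ (a - 1) := by
        rw [← pow_succ, ← Real.rpow_natCast, ← Real.rpow_add ht0]; push_cast; ring_nf
      have e3 : (1 - t) ^ b = (1 - t) * (1 - t) ^ (b - 1) := by
        nth_rewrite 2 [← Real.rpow_one (1 - t)]
        rw [← Real.rpow_add ht1]; ring_nf
      simp only [jacobiWeight]
      rw [e1, e2, e3]
      ring)
    ((intervalIntegrable_iff_integrableOn_Icc_of_le zero_le_one).2 hint)
  rw [intervalIntegral.integral_of_le zero_le_one, ← integral_Icc_eq_integral_Ioc,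
    integral_sub ((hi m).const_mul _) ((hi (m + 1)).const_mul _), integral_const_mul,
    integral_const_mul] at hFTC
  simp only [sub_self, Real.zero_rpow hb.ne', Real.zero_rpow hm.ne', mul_zero, zero_mul] at hFTC
  simpa only [jacobiMoment] using sub_eq_zero.1 hFTC

/-- The product Jacobi weight is integrable against polynomials on the cube. -/
lemma integrableOn_eval_mul_prod_jacobiWeight {N : ℕ} {a b : ℝ} (ha : 0 < a) (hb : 0 < b)
    (G : MvPolynomial (Fin N) ℝ) :
    IntegrableOn (fun x : Fin N → ℝ => eval x G * ∏ i, jacobiWeight a b (x i))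
      (Set.univ.pi fun _ => Set.Icc (0 : ℝ) 1) := by
  induction G using MvPolynomial.induction_on' with
  | monomial s c =>
    have h : Integrable (fun x : Fin N → ℝ => ∏ i, (x i ^ s i * jacobiWeight a b (x i)))
        (Measure.pi fun _ => volume.restrict (Set.Icc (0 : ℝ) 1)) :=
      Integrable.fintype_prod (f := fun i t => t ^ s i * jacobiWeight a b t)
        fun i => integrableOn_pow_mul_jacobiWeight ha hb (s i)
    rw [← Measure.restrict_pi_pi] at h
    refine (h.const_mul c).congr (Filter.Eventually.of_forall fun x => ?_)
    simp [eval_monomial, Finsupp.prod_fintype, Finset.prod_mul_distrib, mul_assoc]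
  | add p q hp hq =>
    simp only [map_add, add_mul]
    exact hp.add hq

/-- Integration of a polynomial against the product Jacobi weight on the cube. -/
noncomputable def jacobiIntegral (N : ℕ) {a b : ℝ} (ha : 0 < a) (hb : 0 < b) :
    MvPolynomial (Fin N) ℝ →ₗ[ℝ] ℝ where
  toFun G := ∫ x in Set.univ.pi fun _ : Fin N => Set.Icc (0 : ℝ) 1,
    eval x G * ∏ i, jacobiWeight a b (x i)
  map_add' p q := by
    simp only [map_add, add_mul]
    exact integral_add (integrableOn_eval_mul_prod_jacobiWeight ha hb p)
      (integrableOn_eval_mul_prod_jacobiWeight ha hb q)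
  map_smul' c p := by
    simp only [smul_eval, mul_assoc, integral_const_mul, RingHom.id_apply, smul_eq_mul]

lemma jacobiIntegral_monomial {N : ℕ} {a b : ℝ} (ha : 0 < a) (hb : 0 < b)
    (s : Fin N →₀ ℕ) (c : ℝ) :
    jacobiIntegral N ha hb (monomial s c) = c * ∏ i, jacobiMoment a b (s i) := by
  have h := integral_fintype_prod_eq_prod (𝕜 := ℝ) (fun (i : Fin N) (t : ℝ) =>
    t ^ s i * jacobiWeight a b t) (μ := fun _ => volume.restrict (Set.Icc (0 : ℝ) 1))
  rw [← Measure.restrict_pi_pi] at h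
  simp only [jacobiMoment]
  rw [← h, ← integral_const_mul]
  refine integral_congr_ae (Filter.Eventually.of_forall fun x => ?_)
  simp [eval_monomial, Finsupp.prod_fintype, Finset.prod_mul_distrib, mul_assoc]

/-- Integration by parts in the `i`-th variable. -/
lemma jacobiIntegral_pderiv {N : ℕ} {a b : ℝ} (ha : 0 < a) (hb : 0 < b) (i : Fin N)
    (G : MvPolynomial (Fin N) ℝ) :
    jacobiIntegral N ha hb
      (C a * G - C (a + b) * (X i * G) + X i * pderiv i G - X i * (X i * pderiv i G)) = 0 := by
  induction G using MvPolynomial.induction_on' with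
  | monomial s c =>
    have hX : X i * monomial s c = monomial (s + Finsupp.single i 1) c := by
      rw [X, monomial_mul, one_mul, add_comm]
    rw [X_mul_pderiv_monomial, mul_smul_comm, hX, ← smul_eq_C_mul, ← smul_eq_C_mul]
    simp only [map_sub, map_add, map_smul, map_nsmul, jacobiIntegral_monomial]
    have hne : ∀ j ∈ Finset.univ.erase i, jacobiMoment a b ((s + Finsupp.single i 1 : Fin N →₀ ℕ) j)
        = jacobiMoment a b (s j) := by
      intro j hj
      simp [(Finset.ne_of_mem_erase hj).symm]
    rw [← Finset.mul_prod_erase _ _ (Finset.mem_univ i),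
      ← Finset.mul_prod_erase _ (fun j => jacobiMoment a b ((s + Finsupp.single i 1 : Fin N →₀ ℕ) j))
        (Finset.mem_univ i), Finset.prod_congr rfl hne]
    have h := jacobiMoment_succ ha hb (s i)
    simp only [Finsupp.add_apply, Finsupp.single_eq_same, smul_eq_mul, nsmul_eq_mul]
    linear_combination (c * ∏ j ∈ Finset.univ.erase i, jacobiMoment a b (s j)) * h
  | add p q hp hq =>
    rw [← add_zero (0 : ℝ)]
    nth_rewrite 1 [← hp]
    rw [← hq, ← map_add]
    congr 1
    simp only [map_add]
    ring

/-- The derivation of the polynomial ring attached to the vector field with components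
`x_i ^ (k + 1) * (1 - x_i)`. -/
noncomputable def jacobiField (N k : ℕ) :
    Derivation ℝ (MvPolynomial (Fin N) ℝ) (MvPolynomial (Fin N) ℝ) :=
  mkDerivation ℝ fun i => X i ^ (k + 1) - X i ^ (k + 2)

lemma jacobiField_apply (N k : ℕ) (F : MvPolynomial (Fin N) ℝ) :
    jacobiField N k F = ∑ i, (X i ^ (k + 1) - X i ^ (k + 2)) * pderiv i F := by
  have hs : ∀ G : MvPolynomial (Fin N) ℝ,
      (∑ i, (X i ^ (k + 1) - X i ^ (k + 2) : MvPolynomial (Fin N) ℝ) • pderiv i) G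
        = ∑ i, (X i ^ (k + 1) - X i ^ (k + 2)) * pderiv i G := by
    intro G
    change Derivation.coeFnAddMonoidHom (∑ i, _) G = _
    rw [map_sum, Finset.sum_apply]
    rfl
  have h : jacobiField N k
      = ∑ i, (X i ^ (k + 1) - X i ^ (k + 2) : MvPolynomial (Fin N) ℝ) • pderiv i := by
    refine derivation_ext fun j => ?_
    rw [jacobiField, mkDerivation_X, hs]
    simp [pderiv_X, Pi.single_apply]
  rw [h, hs]

lemma jacobiField_psum (N k j : ℕ) :
    jacobiField N k (psum (Fin N) ℝ j)
      = j * (psum (Fin N) ℝ (j + k) - psum (Fin N) ℝ (j + k + 1)) := by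
  rcases j with _ | j
  · simp [psum]
  · simp only [psum, map_sum, Derivation.leibniz_pow, jacobiField, mkDerivation_X, smul_eq_mul,
      nsmul_eq_mul, ← Finset.sum_sub_distrib, Finset.mul_sum]
    refine Finset.sum_congr rfl fun i _ => ?_
    rw [Nat.add_sub_cancel]
    ring

lemma derivation_prod_of_eq_mul {R A ι : Type*} [CommRing R] [CommRing A] [Algebra R A]
    (D : Derivation R A A) (s : Finset ι) (f c : ι → A) (h : ∀ i ∈ s, D (f i) = c i * f i) :
    D (∏ i ∈ s, f i) = (∑ i ∈ s, c i) * ∏ i ∈ s, f i := by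
  classical
  induction s using Finset.induction_on with
  | empty => simp
  | insert i s hi ih =>
    rw [Finset.prod_insert hi, Finset.sum_insert hi, Derivation.leibniz,
      ih fun j hj => h j (Finset.mem_insert_of_mem hj), h i (Finset.mem_insert_self i s),
      smul_eq_mul, smul_eq_mul]
    ring

/-- The squared Vandermonde product as a polynomial. -/
noncomputable def vandermondeSq (N : ℕ) : MvPolynomial (Fin N) ℝ :=
  ∏ i, ∏ j ∈ Finset.Ioi i, (X i - X j) ^ 2

/-- The logarithmic derivative of `X i - X j` along `jacobiField`. -/
noncomputable def jacobiLogDeriv (N k : ℕ) (i j : Fin N) : MvPolynomial (Fin N) ℝ :=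
  ∑ l ∈ Finset.range (k + 1), X i ^ l * X j ^ (k - l)
    - ∑ l ∈ Finset.range (k + 2), X i ^ l * X j ^ (k + 1 - l)

lemma jacobiField_X_sub_X (N k : ℕ) (i j : Fin N) :
    jacobiField N k (X i - X j) = jacobiLogDeriv N k i j * (X i - X j) := by
  have h1 := geom_sum₂_mul (X i : MvPolynomial (Fin N) ℝ) (X j) (k + 1)
  have h2 := geom_sum₂_mul (X i : MvPolynomial (Fin N) ℝ) (X j) (k + 2)
  simp only [Nat.add_sub_cancel, show k + 2 - 1 = k + 1 from rfl] at h1 h2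
  rw [map_sub, jacobiField, mkDerivation_X, mkDerivation_X, jacobiLogDeriv]
  linear_combination h2 - h1

lemma jacobiLogDeriv_comm (N k : ℕ) (i j : Fin N) :
    jacobiLogDeriv N k i j = jacobiLogDeriv N k j i := by
  have h1 := (Commute.all (X i : MvPolynomial (Fin N) ℝ) (X j)).geom_sum₂_comm (k + 1)
  have h2 := (Commute.all (X i : MvPolynomial (Fin N) ℝ) (X j)).geom_sum₂_comm (k + 2)
  simp only [Nat.add_sub_cancel, show k + 2 - 1 = k + 1 from rfl] at h1 h2
  rw [jacobiLogDeriv, jacobiLogDeriv, h1, h2]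

lemma jacobiLogDeriv_self (N k : ℕ) (i : Fin N) :
    jacobiLogDeriv N k i i = ((k : MvPolynomial (Fin N) ℝ) + 1) * X i ^ k
      - ((k : MvPolynomial (Fin N) ℝ) + 2) * X i ^ (k + 1) := by
  have h1 := geom_sum₂_self (X i : MvPolynomial (Fin N) ℝ) (k + 1)
  have h2 := geom_sum₂_self (X i : MvPolynomial (Fin N) ℝ) (k + 2)
  simp only [Nat.add_sub_cancel, show k + 2 - 1 = k + 1 from rfl] at h1 h2
  rw [jacobiLogDeriv, h1, h2]
  push_cast
  ring

lemma sum_sum_X_pow_mul_X_pow (N m n : ℕ) :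
    ∑ i : Fin N, ∑ j : Fin N, (X i ^ m * X j ^ n : MvPolynomial (Fin N) ℝ)
      = psum (Fin N) ℝ m * psum (Fin N) ℝ n := by
  simp only [psum, Finset.sum_mul_sum]

lemma sum_sum_Ioi_jacobiLogDeriv (N k : ℕ) :
    ∑ i : Fin N, ∑ j ∈ Finset.Ioi i, 2 * jacobiLogDeriv N k i j
      = ∑ l ∈ Finset.range (k + 1), psum (Fin N) ℝ l * psum (Fin N) ℝ (k - l)
        - ∑ l ∈ Finset.range (k + 2), psum (Fin N) ℝ l * psum (Fin N) ℝ (k + 1 - l)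
        - ((k + 1) * psum (Fin N) ℝ k - (k + 2) * psum (Fin N) ℝ (k + 1)) := by
  have h1 : ∑ i : Fin N, ∑ j ∈ Finset.Ioi i, 2 * jacobiLogDeriv N k i j
      = ∑ i : Fin N, ∑ j ∈ {i}ᶜ, jacobiLogDeriv N k j i := by
    rw [← Finset.sum_sum_Ioi_add_eq_sum_sum_off_diag]
    refine Finset.sum_congr rfl fun i _ => Finset.sum_congr rfl fun j _ => ?_
    rw [jacobiLogDeriv_comm N k j i, two_mul]
  have h2 : ∀ i : Fin N, ∑ j ∈ {i}ᶜ, jacobiLogDeriv N k j i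
      = ∑ j, jacobiLogDeriv N k i j - jacobiLogDeriv N k i i := by
    intro i
    rw [eq_sub_iff_add_eq, ← Finset.sum_compl_add_sum {i}, Finset.sum_singleton]
    simp only [jacobiLogDeriv_comm N k _ i]
  have h3 : ∑ i : Fin N, ∑ j, jacobiLogDeriv N k i j
      = ∑ l ∈ Finset.range (k + 1), psum (Fin N) ℝ l * psum (Fin N) ℝ (k - l)
        - ∑ l ∈ Finset.range (k + 2), psum (Fin N) ℝ l * psum (Fin N) ℝ (k + 1 - l) := by
    simp only [← sum_sum_X_pow_mul_X_pow, jacobiLogDeriv, Finset.sum_sub_distrib]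
    have hc : ∀ (n : ℕ) (f : ℕ → Fin N → Fin N → MvPolynomial (Fin N) ℝ),
        ∑ i, ∑ j, ∑ l ∈ Finset.range n, f l i j = ∑ l ∈ Finset.range n, ∑ i, ∑ j, f l i j := by
      intro n f
      rw [Finset.sum_congr rfl fun i _ => Finset.sum_comm, Finset.sum_comm]
    rw [hc, hc]
  rw [h1, Finset.sum_congr rfl fun i _ => h2 i, Finset.sum_sub_distrib, h3]
  simp only [jacobiLogDeriv_self, Finset.sum_sub_distrib, ← Finset.mul_sum]
  rfl

lemma jacobiField_vandermondeSq (N k : ℕ) :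
    jacobiField N k (vandermondeSq N)
      = (∑ i, ∑ j ∈ Finset.Ioi i, 2 * jacobiLogDeriv N k i j) * vandermondeSq N := by
  refine derivation_prod_of_eq_mul _ _ _ _ fun i _ =>
    derivation_prod_of_eq_mul _ _ _ _ fun j _ => ?_
  rw [Derivation.leibniz_pow, jacobiField_X_sub_X, nsmul_eq_mul, smul_eq_mul]
  push_cast
  ring

/-- The divergence of `jacobiField` with respect to the Jacobi ensemble. -/
noncomputable def jacobiDiv (N k : ℕ) (a b : ℝ) : MvPolynomial (Fin N) ℝ :=
  C (a - 1) * psum (Fin N) ℝ k - C (a + b - 2) * psum (Fin N) ℝ (k + 1)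
    + ∑ l ∈ Finset.range (k + 1), psum (Fin N) ℝ l * psum (Fin N) ℝ (k - l)
    - ∑ l ∈ Finset.range (k + 2), psum (Fin N) ℝ l * psum (Fin N) ℝ (k + 1 - l)

/-- The loop equations (Schwinger-Dyson equations) of the Jacobi ensemble. -/
lemma jacobiIntegral_loop_equation {N : ℕ} {a b : ℝ} (ha : 0 < a) (hb : 0 < b) (k : ℕ)
    (F : MvPolynomial (Fin N) ℝ) :
    jacobiIntegral N ha hb
      ((jacobiDiv N k a b * F + jacobiField N k F) * vandermondeSq N) = 0 := by
  have hsum : ∑ i : Fin N, jacobiIntegral N ha hb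
      (C a * (X i ^ k * (F * vandermondeSq N))
        - C (a + b) * (X i * (X i ^ k * (F * vandermondeSq N)))
        + X i * pderiv i (X i ^ k * (F * vandermondeSq N))
        - X i * (X i * pderiv i (X i ^ k * (F * vandermondeSq N)))) = 0 :=
    Finset.sum_eq_zero fun i _ => jacobiIntegral_pderiv ha hb i _
  rw [← map_sum] at hsum
  rw [← hsum]
  congr 1
  have hi : ∀ (i : Fin N) (H : MvPolynomial (Fin N) ℝ),
      X i * pderiv i (X i ^ k * H) = (k : MvPolynomial (Fin N) ℝ) * X i ^ k * H
        + X i ^ (k + 1) * pderiv i H := by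
    intro i H
    rcases k with _ | k
    · simp
    · rw [pderiv_mul, pderiv_pow, pderiv_X_self, Nat.add_sub_cancel]
      ring
  have hD : jacobiField N k (F * vandermondeSq N)
      = F * jacobiField N k (vandermondeSq N) + vandermondeSq N * jacobiField N k F := by
    rw [Derivation.leibniz, smul_eq_mul, smul_eq_mul]
  have hH : ∀ H : MvPolynomial (Fin N) ℝ,
      ∑ i : Fin N, (C a * (X i ^ k * H) - C (a + b) * (X i * (X i ^ k * H))
        + X i * pderiv i (X i ^ k * H) - X i * (X i * pderiv i (X i ^ k * H)))
      = ((C a + (k : MvPolynomial (Fin N) ℝ)) * psum (Fin N) ℝ k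
          - (C (a + b) + (k : MvPolynomial (Fin N) ℝ)) * psum (Fin N) ℝ (k + 1)) * H
        + jacobiField N k H := by
    intro H
    rw [jacobiField_apply]
    simp only [psum, hi, Finset.mul_sum, ← Finset.sum_sub_distrib, Finset.sum_mul,
      ← Finset.sum_add_distrib]
    refine Finset.sum_congr rfl fun i _ => ?_
    ring
  rw [hH, hD, jacobiField_vandermondeSq, sum_sum_Ioi_jacobiLogDeriv, jacobiDiv]
  simp only [map_sub, map_add, map_one, map_ofNat]
  ring

/-- Families, indexed by `n`, of polynomials in `n + 1` variables. -/
abbrev PolyFamily : Type := ∀ n : ℕ, MvPolynomial (Fin (n + 1)) ℝ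

/-- The unit cube `[0, 1] ^ N`. -/
abbrev unitCube (N : ℕ) : Set (Fin N → ℝ) := Set.univ.pi fun _ => Set.Icc (0 : ℝ) 1

/-- Families of polynomials which are uniformly bounded on the unit cubes. -/
def boundedFamilies : Subring PolyFamily where
  carrier := {f | ∃ B : ℝ, ∀ n, ∀ x ∈ unitCube (n + 1), |eval x (f n)| ≤ B}
  mul_mem' := by
    rintro f g ⟨B, hB⟩ ⟨B', hB'⟩
    refine ⟨B * B', fun n x hx => ?_⟩
    rw [Pi.mul_apply, map_mul, abs_mul]
    exact mul_le_mul (hB n x hx) (hB' n x hx) (abs_nonneg _) ((abs_nonneg _).trans (hB n x hx))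
  one_mem' := ⟨1, by simp⟩
  add_mem' := by
    rintro f g ⟨B, hB⟩ ⟨B', hB'⟩
    refine ⟨B + B', fun n x hx => ?_⟩
    rw [Pi.add_apply, map_add]
    exact (abs_add_le _ _).trans (add_le_add (hB n x hx) (hB' n x hx))
  zero_mem' := ⟨0, by simp⟩
  neg_mem' := by
    rintro f ⟨B, hB⟩
    exact ⟨B, fun n x hx => by simpa using hB n x hx⟩

lemma const_mem_boundedFamilies {s : ℕ → ℝ} {c : ℝ}
    (hs : Filter.Tendsto s Filter.atTop (nhds c)) :
    (fun n => C (s n) : PolyFamily) ∈ boundedFamilies := by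
  obtain ⟨B, hB⟩ := isBounded_iff_forall_norm_le.1 (Metric.isBounded_range_of_tendsto s hs)
  exact ⟨B, fun n x _ => by simpa using hB (s n) ⟨n, rfl⟩⟩

/-- Families of polynomials which are uniformly bounded on the unit cubes together with their
derivatives along `jacobiField`. -/
def boundedFieldFamilies (k : ℕ) : Subring PolyFamily where
  carrier := {f | f ∈ boundedFamilies ∧
    (fun n => jacobiField (n + 1) k (f n) : PolyFamily) ∈ boundedFamilies}
  mul_mem' := by
    rintro f g ⟨hf, hf'⟩ ⟨hg, hg'⟩
    refine ⟨mul_mem hf hg, ?_⟩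
    convert add_mem (mul_mem hf hg') (mul_mem hg hf') using 1
    ext1 n
    simp
  one_mem' := ⟨one_mem _, by
    convert zero_mem boundedFamilies using 1
    ext1 n
    simp⟩
  add_mem' := by
    rintro f g ⟨hf, hf'⟩ ⟨hg, hg'⟩
    refine ⟨add_mem hf hg, ?_⟩
    convert add_mem hf' hg' using 1
    ext1 n
    simp
  zero_mem' := ⟨zero_mem _, by
    convert zero_mem boundedFamilies using 1
    ext1 n
    simp⟩
  neg_mem' := by
    rintro f ⟨hf, hf'⟩
    refine ⟨neg_mem hf, ?_⟩
    convert neg_mem hf' using 1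
    ext1 n
    simp

lemma const_mem_boundedFieldFamilies (k : ℕ) {s : ℕ → ℝ} {c : ℝ}
    (hs : Filter.Tendsto s Filter.atTop (nhds c)) :
    (fun n => C (s n) : PolyFamily) ∈ boundedFieldFamilies k :=
  ⟨const_mem_boundedFamilies hs, by
    convert zero_mem boundedFamilies using 1
    ext1 n
    simp⟩

/-- The normalized power sums `p_j / N`. -/
noncomputable def normPsum (j : ℕ) : PolyFamily := fun n =>
  C ((n + 1 : ℝ)⁻¹) * psum (Fin (n + 1)) ℝ j

lemma normPsum_zero : normPsum 0 = 1 := by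
  ext1 n
  have h : (n + 1 : MvPolynomial (Fin (n + 1)) ℝ) = C (n + 1 : ℝ) := by simp
  simp only [normPsum, psum, pow_zero, Finset.sum_const, Finset.card_univ, Fintype.card_fin,
    nsmul_eq_mul, mul_one, Pi.one_apply]
  push_cast
  rw [h, ← C_mul, inv_mul_cancel₀ (by positivity), C_1]

lemma normPsum_mem_boundedFamilies (j : ℕ) : normPsum j ∈ boundedFamilies := by
  refine ⟨1, fun n x hx => ?_⟩
  have hx' : ∀ i, 0 ≤ x i ∧ x i ≤ 1 := fun i => hx i (Set.mem_univ i)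
  have h0 : 0 ≤ ∑ i, x i ^ j := Finset.sum_nonneg fun i _ => pow_nonneg (hx' i).1 j
  have h1 : ∑ i, x i ^ j ≤ n + 1 := by
    calc ∑ i, x i ^ j ≤ ∑ _i : Fin (n + 1), (1 : ℝ) :=
          Finset.sum_le_sum fun i _ => pow_le_one₀ (hx' i).1 (hx' i).2
      _ = n + 1 := by simp
  simp only [normPsum, psum, map_mul, eval_C, map_sum, map_pow, eval_X]
  rw [abs_of_nonneg (by positivity), inv_mul_le_iff₀ (by positivity), mul_one]
  exact h1

lemma normPsum_mem_boundedFieldFamilies (k j : ℕ) : normPsum j ∈ boundedFieldFamilies k := by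
  refine ⟨normPsum_mem_boundedFamilies j, ?_⟩
  convert mul_mem (natCast_mem boundedFamilies j)
    (sub_mem (normPsum_mem_boundedFamilies (j + k)) (normPsum_mem_boundedFamilies (j + k + 1)))
    using 1
  ext1 n
  simp only [normPsum, ← smul_eq_C_mul, Derivation.map_smul, jacobiField_psum, Pi.mul_apply,
    Pi.natCast_apply, Pi.sub_apply]
  rw [← smul_sub, mul_smul_comm]

/-- A normalized linear functional on polynomials which is positive on the unit cube. -/
structure IsCubeState {N : ℕ} (E : MvPolynomial (Fin N) ℝ →ₗ[ℝ] ℝ) : Prop where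
  map_one : E 1 = 1
  nonneg : ∀ G, (∀ x ∈ unitCube N, 0 ≤ eval x G) → 0 ≤ E G

namespace IsCubeState

variable {N : ℕ} {E : MvPolynomial (Fin N) ℝ →ₗ[ℝ] ℝ}

lemma mono (hE : IsCubeState E) {F G : MvPolynomial (Fin N) ℝ}
    (h : ∀ x ∈ unitCube N, eval x F ≤ eval x G) : E F ≤ E G := by
  rw [← sub_nonneg, ← map_sub]
  exact hE.nonneg _ fun x hx => by simpa using h x hx

lemma sq_nonneg (hE : IsCubeState E) (F : MvPolynomial (Fin N) ℝ) : 0 ≤ E (F ^ 2) :=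
  hE.nonneg _ fun x _ => by simpa using _root_.sq_nonneg (eval x F)

lemma map_C (hE : IsCubeState E) (c : ℝ) : E (C c) = c := by
  rw [← mul_one (C c), ← smul_eq_C_mul, map_smul, hE.map_one, smul_eq_mul, mul_one]

/-- The Cauchy-Schwarz inequality in the form `(E F - c) ^ 2 ≤ E ((F - c) ^ 2)`. -/
lemma sub_sq_le (hE : IsCubeState E) (F : MvPolynomial (Fin N) ℝ) (c : ℝ) :
    (E F - c) ^ 2 ≤ E ((F - C c) ^ 2) := by
  have h : (F - C c) ^ 2
      = (F - C (E F)) ^ 2 + (2 * (E F - c)) • (F - C (E F)) + C ((E F - c) ^ 2) := by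
    simp only [smul_eq_C_mul, map_mul, map_sub, map_pow, map_ofNat]
    ring
  rw [h, map_add, map_add, map_smul, map_sub, hE.map_C, hE.map_C, sub_self, smul_zero, add_zero]
  exact le_add_of_nonneg_left (hE.sq_nonneg _)

end IsCubeState

/-- Uniformly bounded families of polynomials which converge to a constant in mean square. -/
def concentratedFamilies {E : ∀ n : ℕ, MvPolynomial (Fin (n + 1)) ℝ →ₗ[ℝ] ℝ}
    (hE : ∀ n, IsCubeState (E n)) : Subring PolyFamily where
  carrier := {f | f ∈ boundedFamilies ∧
    ∃ c : ℝ, Filter.Tendsto (fun n => E n ((f n - C c) ^ 2)) Filter.atTop (nhds 0)}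
  mul_mem' := by
    rintro f g ⟨hf, c, hc⟩ ⟨hg, d, hd⟩
    refine ⟨mul_mem hf hg, c * d, ?_⟩
    obtain ⟨B, hB⟩ := hf
    have hlim := (hd.const_mul (2 * B ^ 2)).add (hc.const_mul (2 * d ^ 2))
    rw [mul_zero, mul_zero, add_zero] at hlim
    refine squeeze_zero (fun n => (hE n).sq_nonneg _) (fun n => ?_) hlim
    rw [← smul_eq_mul (2 * B ^ 2), ← smul_eq_mul (2 * d ^ 2), ← map_smul, ← map_smul, ← map_add]
    refine (hE n).mono fun x hx => ?_
    have h := sq_le_sq' (neg_le_of_abs_le (hB n x hx)) (le_of_abs_le (hB n x hx))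
    simp only [Pi.mul_apply, map_add, map_sub, map_mul, map_pow, eval_C, smul_eval]
    nlinarith [sq_nonneg (eval x (f n) * (eval x (g n) - d) - d * (eval x (f n) - c)),
      mul_le_mul_of_nonneg_right h (sq_nonneg (eval x (g n) - d))]
  one_mem' := ⟨one_mem _, 1, by simp⟩
  add_mem' := by
    rintro f g ⟨hf, c, hc⟩ ⟨hg, d, hd⟩
    refine ⟨add_mem hf hg, c + d, ?_⟩
    have hlim := (hc.const_mul 2).add (hd.const_mul 2)
    rw [mul_zero, add_zero] at hlim
    refine squeeze_zero (fun n => (hE n).sq_nonneg _) (fun n => ?_) hlim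
    rw [← smul_eq_mul, ← smul_eq_mul, ← map_smul, ← map_smul, ← map_add]
    refine (hE n).mono fun x hx => ?_
    simp only [Pi.add_apply, map_add, map_sub, map_pow, eval_C, smul_eval]
    nlinarith [sq_nonneg ((eval x (f n) - c) - (eval x (g n) - d))]
  zero_mem' := ⟨zero_mem _, 0, by simp⟩
  neg_mem' := by
    rintro f ⟨hf, c, hc⟩
    refine ⟨neg_mem hf, -c, ?_⟩
    convert! hc using 3 with n
    rw [Pi.neg_apply, C_neg]
    ring

section

variable {E : ∀ n : ℕ, MvPolynomial (Fin (n + 1)) ℝ →ₗ[ℝ] ℝ}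

lemma const_mem_concentratedFamilies (hE : ∀ n, IsCubeState (E n)) {s : ℕ → ℝ} {c : ℝ}
    (hs : Filter.Tendsto s Filter.atTop (nhds c)) :
    (fun n => C (s n) : PolyFamily) ∈ concentratedFamilies hE := by
  refine ⟨const_mem_boundedFamilies hs, c, ?_⟩
  have h := (hs.sub_const c).pow 2
  rw [sub_self, zero_pow two_ne_zero] at h
  simpa only [← map_sub, ← map_pow, (hE _).map_C] using h

lemma exists_tendsto_of_mem_concentratedFamilies (hE : ∀ n, IsCubeState (E n)) {f : PolyFamily}
    (hf : f ∈ concentratedFamilies hE) :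
    ∃ c : ℝ, Filter.Tendsto (fun n => E n (f n)) Filter.atTop (nhds c) := by
  obtain ⟨-, c, hc⟩ := hf
  refine ⟨c, ?_⟩
  have h := squeeze_zero (fun n => sq_nonneg (E n (f n) - c)) (fun n => (hE n).sub_sq_le _ c) hc
  have h' := h.sqrt
  simp only [Real.sqrt_sq_eq_abs, Real.sqrt_zero] at h'
  exact tendsto_sub_nhds_zero_iff.1 ((tendsto_zero_iff_abs_tendsto_zero _).2 h')

/-- The divergence `jacobiDiv` divided by the square of the number of variables. -/
noncomputable def normDiv (k : ℕ) (a b : ℕ → ℝ) : PolyFamily := fun n =>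
  C (((n + 1 : ℝ) ^ 2)⁻¹) * jacobiDiv (n + 1) k (a n) (b n)

lemma normDiv_eq (k : ℕ) (a b : ℕ → ℝ) :
    normDiv k a b = (fun n => C ((a n - 1) / (n + 1 : ℝ))) * normPsum k
      - (fun n => C ((a n + b n - 2) / (n + 1 : ℝ))) * normPsum (k + 1)
      + ∑ l ∈ Finset.range (k + 1), normPsum l * normPsum (k - l)
      - ∑ l ∈ Finset.range (k + 2), normPsum l * normPsum (k + 1 - l) := by
  ext1 n
  simp only [normDiv, jacobiDiv, Pi.sub_apply, Pi.add_apply, Pi.mul_apply, Finset.sum_apply,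
    normPsum, mul_sub, mul_add, Finset.mul_sum, div_eq_mul_inv, ← inv_pow, map_mul, map_pow]
  refine congrArg₂ (· - ·) (congrArg₂ (· + ·) ?_ ?_) ?_
  · ring
  · exact Finset.sum_congr rfl fun l _ => by ring
  · exact Finset.sum_congr rfl fun l _ => by ring

lemma normDiv_mem_concentratedFamilies (hE : ∀ n, IsCubeState (E n)) {a b : ℕ → ℝ} {α β : ℝ}
    (ha : Filter.Tendsto (fun n => (a n - 1) / (n + 1 : ℝ)) Filter.atTop (nhds α))
    (hb : Filter.Tendsto (fun n => (a n + b n - 2) / (n + 1 : ℝ)) Filter.atTop (nhds β))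
    (k : ℕ)
    (hloop : ∀ n F, E n (jacobiDiv (n + 1) k (a n) (b n) * F + jacobiField (n + 1) k F) = 0) :
    normDiv k a b ∈ concentratedFamilies hE := by
  have hmem : normDiv k a b ∈ boundedFieldFamilies k := by
    rw [normDiv_eq]
    have hq := normPsum_mem_boundedFieldFamilies k
    exact sub_mem (add_mem (sub_mem (mul_mem (const_mem_boundedFieldFamilies k ha) (hq _))
      (mul_mem (const_mem_boundedFieldFamilies k hb) (hq _)))
      (sum_mem fun l _ => mul_mem (hq _) (hq _))) (sum_mem fun l _ => mul_mem (hq _) (hq _))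
  obtain ⟨hbdd, B, hB⟩ := hmem
  refine ⟨hbdd, 0, ?_⟩
  have hlim : Filter.Tendsto (fun n : ℕ => (1 / ((n : ℝ) + 1)) ^ 2 * B) Filter.atTop (nhds 0) := by
    simpa using (tendsto_one_div_add_atTop_nhds_zero_nat.pow 2).mul_const B
  refine squeeze_zero (fun n => (hE n).sq_nonneg _) (fun n => ?_) hlim
  have hdiv : jacobiDiv (n + 1) k (a n) (b n) = C ((n + 1 : ℝ) ^ 2) * normDiv k a b n := by
    rw [normDiv, ← mul_assoc, ← C_mul, mul_inv_cancel₀ (by positivity), C_1, one_mul]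
  have h1 := hloop n (normDiv k a b n)
  have h2 : E n (-jacobiField (n + 1) k (normDiv k a b n)) ≤ B := by
    rw [← (hE n).map_C B]
    refine (hE n).mono fun x hx => ?_
    simpa using neg_le.1 (neg_le_of_abs_le (hB n x hx))
  rw [hdiv, mul_assoc, ← sq, map_add, ← smul_eq_C_mul, map_smul, smul_eq_mul] at h1
  rw [map_neg] at h2
  rw [C_0, sub_zero, one_div, inv_pow, ← div_eq_inv_mul, le_div_iff₀ (by positivity)]
  linarith

lemma normPsum_mem_concentratedFamilies (hE : ∀ n, IsCubeState (E n)) {a b : ℕ → ℝ} {α β : ℝ}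
    (ha : Filter.Tendsto (fun n => (a n - 1) / (n + 1 : ℝ)) Filter.atTop (nhds α))
    (hb : Filter.Tendsto (fun n => (a n + b n - 2) / (n + 1 : ℝ)) Filter.atTop (nhds β))
    (hβ : β + 2 ≠ 0) (hab : ∀ n : ℕ, (a n + b n - 2) / (n + 1 : ℝ) + 2 ≠ 0)
    (hloop : ∀ k n F,
      E n (jacobiDiv (n + 1) k (a n) (b n) * F + jacobiField (n + 1) k F) = 0) (k : ℕ) :
    normPsum k ∈ concentratedFamilies hE := by
  induction k using Nat.strong_induction_on with
  | _ k ih =>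
    rcases k with _ | k
    · rw [normPsum_zero]
      exact one_mem _
    have hk : normPsum (k + 1) = (fun n => C (((a n + b n - 2) / (n + 1 : ℝ) + 2)⁻¹)) *
        ((fun n => C ((a n - 1) / (n + 1 : ℝ))) * normPsum k
          + ∑ l ∈ Finset.range (k + 1), normPsum l * normPsum (k - l)
          - ∑ l ∈ Finset.range k, normPsum (l + 1) * normPsum (k - l) - normDiv k a b) := by
      have hinv : (fun n => C (((a n + b n - 2) / (n + 1 : ℝ) + 2)⁻¹) : PolyFamily) *
          ((fun n => C ((a n + b n - 2) / (n + 1 : ℝ))) + 2) = 1 := by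
        ext1 n
        rw [Pi.mul_apply, Pi.add_apply, Pi.ofNat_apply, ← map_ofNat C, ← C_add, ← C_mul,
          inv_mul_cancel₀ (hab n), C_1, Pi.one_apply]
      rw [normDiv_eq, Finset.sum_range_succ (n := k + 1),
        Finset.sum_range_succ' (fun l => normPsum l * normPsum (k + 1 - l)) k]
      simp only [Nat.add_sub_add_right, Nat.sub_self, Nat.sub_zero, normPsum_zero, one_mul, mul_one]
      linear_combination (-normPsum (k + 1)) * hinv
    rw [hk]
    refine mul_mem (const_mem_concentratedFamilies hE ((hb.add_const 2).inv₀ hβ)) (sub_mem (sub_mem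
      (add_mem (mul_mem (const_mem_concentratedFamilies hE ha) (ih k (by omega))) ?_) ?_)
      (normDiv_mem_concentratedFamilies hE ha hb k (hloop k)))
    · refine sum_mem fun l hl => ?_
      rw [Finset.mem_range] at hl
      exact mul_mem (ih _ (by omega)) (ih _ (by omega))
    · refine sum_mem fun l hl => ?_
      rw [Finset.mem_range] at hl
      exact mul_mem (ih _ (by omega)) (ih _ (by omega))

end

lemma jacobiIntegral_nonneg {N : ℕ} {a b : ℝ} (ha : 0 < a) (hb : 0 < b)
    {G : MvPolynomial (Fin N) ℝ} (hG : ∀ x ∈ unitCube N, 0 ≤ eval x G) :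
    0 ≤ jacobiIntegral N ha hb G :=
  setIntegral_nonneg (MeasurableSet.univ_pi fun _ => measurableSet_Icc) fun x hx =>
    mul_nonneg (hG x hx) (Finset.prod_nonneg fun i _ => jacobiWeight_nonneg a b (hx i trivial))

lemma eval_vandermondeSq {N : ℕ} (x : Fin N → ℝ) :
    eval x (vandermondeSq N) = ∏ i, ∏ j ∈ Finset.Ioi i, (x i - x j) ^ 2 := by
  simp [vandermondeSq]

lemma eval_vandermondeSq_nonneg {N : ℕ} (x : Fin N → ℝ) : 0 ≤ eval x (vandermondeSq N) := by
  rw [eval_vandermondeSq]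
  exact Finset.prod_nonneg fun i _ => Finset.prod_nonneg fun j _ => sq_nonneg _

lemma jacobiIntegral_vandermondeSq_pos {N : ℕ} {a b : ℝ} (ha : 0 < a) (hb : 0 < b) :
    0 < jacobiIntegral N ha hb (vandermondeSq N) := by
  have hmeas : MeasurableSet (unitCube N) := MeasurableSet.univ_pi fun _ => measurableSet_Icc
  refine (setIntegral_pos_iff_support_of_nonneg_ae ?_
    (integrableOn_eval_mul_prod_jacobiWeight ha hb (vandermondeSq N))).2 ?_
  · filter_upwards [ae_restrict_mem hmeas] with x hx
    exact mul_nonneg (eval_vandermondeSq_nonneg x)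
      (Finset.prod_nonneg fun i _ => jacobiWeight_nonneg a b (hx i trivial))
  · set U : Set (Fin N → ℝ) := (Set.univ.pi fun _ => Set.Ioo (0 : ℝ) 1) ∩
      {x | eval x (vandermondeSq N) ≠ 0}
    have hUo : IsOpen U := (isOpen_set_pi Set.finite_univ fun _ _ => isOpen_Ioo).inter
      (isOpen_ne_fun (MvPolynomial.continuous_eval _) continuous_const)
    have hUne : U.Nonempty := by
      refine ⟨fun i => ((i : ℕ) + 1 : ℝ) / (N + 1), fun i _ => ⟨by positivity, ?_⟩, ?_⟩
      · rw [div_lt_one (by positivity)]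
        exact add_lt_add_left (Nat.cast_lt.2 i.2) 1
      · rw [Set.mem_ofPred_eq, eval_vandermondeSq]
        refine Finset.prod_ne_zero_iff.2 fun i _ => Finset.prod_ne_zero_iff.2 fun j hj => ?_
        have hij : ((i : ℕ) : ℝ) < ((j : ℕ) : ℝ) :=
          Nat.cast_lt.2 (Fin.lt_def.1 (Finset.mem_Ioi.1 hj))
        rw [← sub_div]
        exact pow_ne_zero 2 (div_ne_zero (by linarith) (by positivity))
    refine (hUo.measure_pos volume hUne).trans_le (measure_mono fun x hx => ?_)
    exact ⟨mul_ne_zero hx.2 (Finset.prod_pos fun i _ => jacobiWeight_pos a b (hx.1 i trivial)).ne',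
      fun i _ => Set.Ioo_subset_Icc_self (hx.1 i trivial)⟩

/-- The expectation of a polynomial in the Jacobi ensemble. -/
noncomputable def jacobiExpectation (N : ℕ) {a b : ℝ} (ha : 0 < a) (hb : 0 < b) :
    MvPolynomial (Fin N) ℝ →ₗ[ℝ] ℝ :=
  (jacobiIntegral N ha hb (vandermondeSq N))⁻¹ •
    (jacobiIntegral N ha hb ∘ₗ LinearMap.mulRight ℝ (vandermondeSq N))

lemma jacobiExpectation_apply {N : ℕ} {a b : ℝ} (ha : 0 < a) (hb : 0 < b)
    (F : MvPolynomial (Fin N) ℝ) :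
    jacobiExpectation N ha hb F = (jacobiIntegral N ha hb (vandermondeSq N))⁻¹ *
      jacobiIntegral N ha hb (F * vandermondeSq N) := rfl

lemma isCubeState_jacobiExpectation {N : ℕ} {a b : ℝ} (ha : 0 < a) (hb : 0 < b) :
    IsCubeState (jacobiExpectation N ha hb) where
  map_one := by
    rw [jacobiExpectation_apply, one_mul,
      inv_mul_cancel₀ (jacobiIntegral_vandermondeSq_pos ha hb).ne']
  nonneg G hG := by
    rw [jacobiExpectation_apply]
    refine mul_nonneg (inv_nonneg.2 (jacobiIntegral_vandermondeSq_pos ha hb).le)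
      (jacobiIntegral_nonneg ha hb fun x hx => ?_)
    rw [map_mul]
    exact mul_nonneg (hG x hx) (eval_vandermondeSq_nonneg x)

lemma jacobiAvg_eval {N : ℕ} {a b : ℝ} (ha : 0 < a) (hb : 0 < b) (F : MvPolynomial (Fin N) ℝ) :
    jacobiAvg N a b (fun x => eval x F)
      = (N.factorial : ℝ)⁻¹ * jacobiIntegral N ha hb (F * vandermondeSq N) := by
  simp only [jacobiAvg, jacobiIntegral, jacobiWeight, LinearMap.coe_mk, AddHom.coe_mk, map_mul,
    eval_vandermondeSq]

lemma Ik_eq_jacobiExpectation (k : ℕ) {N : ℕ} {a b : ℝ} (ha : 0 < a) (hb : 0 < b) :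
    Ik k N a b = jacobiExpectation N ha hb (psum (Fin N) ℝ k) := by
  have h1 : (fun x : Fin N → ℝ => ∑ i, x i ^ k) = fun x => eval x (psum (Fin N) ℝ k) := by
    ext x
    simp [psum]
  have h2 : (fun _ : Fin N → ℝ => (1 : ℝ)) = fun x => eval x (1 : MvPolynomial (Fin N) ℝ) := by
    ext x
    simp
  have hN : ((N.factorial : ℝ))⁻¹ ≠ 0 := inv_ne_zero (Nat.cast_ne_zero.2 N.factorial_ne_zero)
  rw [Ik, h1, h2, jacobiAvg_eval ha hb, jacobiAvg_eval ha hb, one_mul, mul_div_mul_left _ _ hN,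
    jacobiExpectation_apply, div_eq_inv_mul]

lemma tendsto_affine_div_add_one (c d : ℝ) :
    Filter.Tendsto (fun n : ℕ => (c * (n + 1 : ℝ) + d) / (n + 1 : ℝ)) Filter.atTop (nhds c) := by
  have h := (tendsto_one_div_add_atTop_nhds_zero_nat.const_mul d).const_add c
  rw [mul_zero, add_zero] at h
  refine h.congr fun n => ?_
  have : (n + 1 : ℝ) ≠ 0 := by positivity
  field_simp

lemma nonneg_of_affine_pos {c d : ℝ} (h : ∀ N : ℕ, 1 ≤ N → 0 < c * (N : ℝ) + d) : 0 ≤ c := by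
  refine ge_of_tendsto' (tendsto_affine_div_add_one c d) fun n => ?_
  have := h (n + 1) (by omega)
  push_cast at this
  positivity

theorem Ik_div_N_converges (k : ℕ) (hk : 1 ≤ k) (a₁ a₀ b₁ b₀ : ℝ)
    (ha : ∀ N : ℕ, 1 ≤ N → 0 < a₁ * (N : ℝ) + a₀)
    (hb : ∀ N : ℕ, 1 ≤ N → 0 < b₁ * (N : ℝ) + b₀) :
    ∃ L : ℝ, Filter.Tendsto
      (fun N : ℕ => Ik k N (a₁ * (N : ℝ) + a₀) (b₁ * (N : ℝ) + b₀) / (N : ℝ))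
      Filter.atTop (nhds L) := by
  have ha' : ∀ n : ℕ, 0 < a₁ * ((n + 1 : ℕ) : ℝ) + a₀ := fun n => ha (n + 1) (by omega)
  have hb' : ∀ n : ℕ, 0 < b₁ * ((n + 1 : ℕ) : ℝ) + b₀ := fun n => hb (n + 1) (by omega)
  have hE : ∀ n : ℕ, IsCubeState (jacobiExpectation (n + 1) (ha' n) (hb' n)) :=
    fun n => isCubeState_jacobiExpectation (ha' n) (hb' n)
  have hlima : Filter.Tendsto (fun n : ℕ => (a₁ * ((n + 1 : ℕ) : ℝ) + a₀ - 1) / (n + 1 : ℝ))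
      Filter.atTop (nhds a₁) := by
    refine (tendsto_affine_div_add_one a₁ (a₀ - 1)).congr fun n => ?_
    push_cast
    ring
  have hlimb : Filter.Tendsto (fun n : ℕ => (a₁ * ((n + 1 : ℕ) : ℝ) + a₀ +
      (b₁ * ((n + 1 : ℕ) : ℝ) + b₀) - 2) / (n + 1 : ℝ)) Filter.atTop (nhds (a₁ + b₁)) := by
    refine (tendsto_affine_div_add_one (a₁ + b₁) (a₀ + b₀ - 2)).congr fun n => ?_
    push_cast
    ring
  have hne : a₁ + b₁ + 2 ≠ 0 := by
    have h₁ := nonneg_of_affine_pos ha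
    have h₂ := nonneg_of_affine_pos hb
    positivity
  have hmem := normPsum_mem_concentratedFamilies hE hlima hlimb hne
    (fun n => by
      have h : (0 : ℝ) < n + 1 := by positivity
      rw [div_add' _ _ _ h.ne']
      refine (div_pos ?_ h).ne'
      have := n.cast_nonneg (α := ℝ)
      linarith [ha' n, hb' n])
    (fun k n F => by
      rw [jacobiExpectation_apply, jacobiIntegral_loop_equation, mul_zero]) k
  obtain ⟨L, hL⟩ := exists_tendsto_of_mem_concentratedFamilies hE hmem
  refine ⟨L, (Filter.tendsto_add_atTop_iff_nat 1).1 (hL.congr fun n => ?_)⟩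
  rw [Ik_eq_jacobiExpectation k (ha' n) (hb' n), normPsum, ← smul_eq_C_mul, map_smul, smul_eq_mul,
    div_eq_inv_mul]
  push_cast
  rfl
end
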